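/- arXiv:2209.12098 — 3 statements merged into one kernel-verified Lean document; each statement's English description precedes it below -/
import Mathlib

section
/- There exist constants c'' > 0 and C > 0 such that for every θ ∈ (0, π/4), every R > 0, and every ξ ∈ ℝ² with |ξ| ≥ c''/R, one has φ_{R,θ}(ξ) ≥ C/|ξ|⁴. -/
open Real MeasureTheory Set

noncomputable section

/-- Rotation of the plane by angle `ω` about the origin. -/
def rot (ω : ℝ) (p : ℝ × ℝ) : ℝ × ℝ :=
  (p.1 * Real.cos ω - p.2 * Real.sin ω, p.1 * Real.sin ω + p.2 * Real.cos ω)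

/-- Indicator function `1_{r,ν}` of the square `[-r,r]²` rotated counterclockwise by
angle `ν` about the origin. -/
def sqInd (r ν : ℝ) : ℝ × ℝ → ℝ :=
  Set.indicator (rot ν '' (Set.Icc (-r) r ×ˢ Set.Icc (-r) r)) 1

/-- Fourier transform `1̂_{r,ν}(ξ) = ∫_{ℝ²} 1_{r,ν}(x) e^{-2πi x·ξ} dx`. -/
def ftSq (r ν : ℝ) (ξ : ℝ × ℝ) : ℂ :=
  ∫ x : ℝ × ℝ, (sqInd r ν x : ℂ) *
    Complex.exp (-(2 * (π : ℂ) * Complex.I * ((x.1 * ξ.1 + x.2 * ξ.2 : ℝ) : ℂ)))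

/-- Euclidean length `|ξ|` of a plane vector. -/
def nrm (ξ : ℝ × ℝ) : ℝ := Real.sqrt (ξ.1 ^ 2 + ξ.2 ^ 2)

/-- Averaged squared Fourier decay
`φ_{R,θ}(ξ) = (1/(Rθ)) ∫_{R/2}^R ∫_{-θ}^{θ} |1̂_{r,ν}(ξ)|² dν dr`. -/
def phi (R θ : ℝ) (ξ : ℝ × ℝ) : ℝ :=
  (1 / (R * θ)) * ∫ r in (R/2)..R, ∫ ν in (-θ)..θ, ‖ftSq r ν ξ‖ ^ 2

/-- `ξ` has argument `α`, i.e. `ξ = |ξ|(cos α, sin α)`. -/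
def hasArg (ξ : ℝ × ℝ) (α : ℝ) : Prop :=
  ξ = (nrm ξ * Real.cos α, nrm ξ * Real.sin α)

/-- One-dimensional factor of the Fourier transform. -/
def oneS (r u : ℝ) : ℝ := 2 * r * Real.sinc (r * u)

lemma oneS_cont : Continuous (fun p : ℝ × ℝ => oneS p.1 p.2) := by
  unfold oneS
  exact (continuous_const.mul continuous_fst).mul
    (Real.continuous_sinc.comp (continuous_fst.mul continuous_snd))

lemma oneS_neg (r u : ℝ) : oneS r (-u) = oneS r u := by
  simp [oneS, Real.sinc_neg]

lemma oneS_abs (r u : ℝ) : oneS r |u| = oneS r u := by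
  rcases abs_choice u with h | h <;> rw [h]
  exact oneS_neg r u

lemma oneS_of_ne (r u : ℝ) (hr : r ≠ 0) (hu : u ≠ 0) : oneS r u = 2 * Real.sin (r * u) / u := by
  unfold oneS
  rw [Real.sinc_of_ne_zero (mul_ne_zero hr hu)]
  field_simp

lemma integral_oneS (r a : ℝ) (hr : 0 < r) :
    ∫ x in Set.Icc (-r) r, Complex.exp (-(2 * (π : ℂ) * Complex.I * ((x * a : ℝ) : ℂ)))
      = (oneS r (2 * π * a) : ℂ) := by
  rw [integral_Icc_eq_integral_Ioc, ← intervalIntegral.integral_of_le (by linarith)]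
  by_cases ha : a = 0
  · subst ha
    simp [oneS]
    ring
  have hc : (-(2 * π * a)) ≠ 0 := by
    have := Real.pi_pos
    simp [ha, this.ne']
  have h1 : ∀ x : ℝ, Complex.exp (-(2 * (π : ℂ) * Complex.I * ((x * a : ℝ) : ℂ)))
      = (fun t : ℝ => Complex.exp (t * Complex.I)) (x * (-(2 * π * a))) := by
    intro x
    simp only
    congr 1
    push_cast
    ring
  simp_rw [h1]
  rw [intervalIntegral.integral_comp_mul_right (fun t : ℝ => Complex.exp (t * Complex.I)) hc, neg_mul, integral_exp_mul_I_eq_sinc]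
  rw [← oneS_neg]
  unfold oneS
  rw [Complex.real_smul]
  push_cast
  have hc' : (-(2 * (π:ℂ) * a)) ≠ 0 := by exact_mod_cast hc
  have h3 : (-(2 * (π:ℂ) * a))⁻¹ * (-(2 * (π:ℂ) * a)) = 1 := inv_mul_cancel₀ hc'
  linear_combination (2 * (r:ℂ) * (Real.sinc (r * (-(2 * π * a))) : ℂ)) * h3

lemma ftSq_eq (r ν : ℝ) (ξ : ℝ × ℝ) (hr : 0 < r) :
    ftSq r ν ξ = ((oneS r (2 * π * (ξ.1 * Real.cos ν + ξ.2 * Real.sin ν)) *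
      oneS r (2 * π * (-ξ.1 * Real.sin ν + ξ.2 * Real.cos ν)) : ℝ) : ℂ) := by
  set L : ℝ × ℝ →L[ℝ] ℝ × ℝ := (Matrix.toLin (.finTwoProd ℝ) (.finTwoProd ℝ)
    !![Real.cos ν, -Real.sin ν; Real.sin ν, Real.cos ν]).toContinuousLinearMap with hL
  have hLr : ∀ p, L p = rot ν p := by
    intro p
    rw [hL, Matrix.toLin_finTwoProd_toContinuousLinearMap]
    simp [rot]
    constructor <;> ring
  have hfun : rot ν = L := by
    funext p; exact (hLr p).symm
  have hdet : L.det = 1 := by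
    rw [hL]
    simp only [LinearMap.det_toContinuousLinearMap, LinearMap.det_toLin, Matrix.det_fin_two_of]
    have := Real.sin_sq_add_cos_sq ν
    nlinarith
  have hinj : Function.Injective (rot ν) := by
    have hl : Function.LeftInverse (rot (-ν)) (rot ν) := by
      intro p
      have h := Real.sin_sq_add_cos_sq ν
      ext
      · simp [rot]
        linear_combination p.1 * h
      · simp [rot]
        linear_combination p.2 * h
    exact hl.injective
  have hms : MeasurableSet (Set.Icc (-r) r ×ˢ Set.Icc (-r) r) :=
    measurableSet_Icc.prod measurableSet_Icc
  have hd : ∀ x ∈ Set.Icc (-r) r ×ˢ Set.Icc (-r) r,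
      HasFDerivWithinAt (rot ν) L (Set.Icc (-r) r ×ˢ Set.Icc (-r) r) x := by
    intro x _
    rw [hfun]
    exact L.hasFDerivAt.hasFDerivWithinAt
  have himg : MeasurableSet (rot ν '' (Set.Icc (-r) r ×ˢ Set.Icc (-r) r)) := by
    apply IsCompact.measurableSet
    apply (isCompact_Icc.prod isCompact_Icc).image
    rw [hfun]
    exact L.continuous
  unfold ftSq
  have h1 : ∀ x : ℝ × ℝ, (sqInd r ν x : ℂ) *
    Complex.exp (-(2 * (π : ℂ) * Complex.I * ((x.1 * ξ.1 + x.2 * ξ.2 : ℝ) : ℂ)))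
     = (rot ν '' (Set.Icc (-r) r ×ˢ Set.Icc (-r) r)).indicator (fun x : ℝ × ℝ =>
      Complex.exp (-(2 * (π : ℂ) * Complex.I * ((x.1 * ξ.1 + x.2 * ξ.2 : ℝ) : ℂ)))) x := by
    intro x
    unfold sqInd
    by_cases hx : x ∈ rot ν '' (Set.Icc (-r) r ×ˢ Set.Icc (-r) r)
    · rw [Set.indicator_of_mem hx, Set.indicator_of_mem hx]; simp
    · rw [Set.indicator_of_notMem hx, Set.indicator_of_notMem hx]; simp
  simp_rw [h1]
  rw [integral_indicator himg,
    integral_image_eq_integral_abs_det_fderiv_smul volume hms hd hinj.injOn]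
  rw [hdet]
  push_cast
  rw [← integral_oneS _ _ hr, ← integral_oneS _ _ hr, ← setIntegral_prod_mul,
    ← Measure.volume_eq_prod]
  apply integral_congr_ae
  filter_upwards with x
  rw [← Complex.exp_add]
  simp only [abs_one, one_smul, rot]
  congr 1
  push_cast
  ring

lemma J_bound (R k : ℝ) (hk : 0 < k) : |∫ r in (R/2)..R, Real.cos (r * k)| ≤ 2 / k := by
  rw [intervalIntegral.integral_comp_mul_right _ hk.ne', integral_cos, smul_eq_mul, abs_mul,
    abs_of_pos (inv_pos.mpr hk)]
  have h : |Real.sin (R * k) - Real.sin (R / 2 * k)| ≤ 2 := by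
    have h1 := Real.abs_sin_le_one (R * k)
    have h2 := Real.abs_sin_le_one (R / 2 * k)
    rw [abs_le] at h1 h2 ⊢
    constructor <;> linarith [h1.1, h1.2, h2.1, h2.2]
  rw [div_eq_inv_mul 2 k]
  exact mul_le_mul_of_nonneg_left h (inv_pos.mpr hk).le

lemma J_triv (R k : ℝ) (hR : 0 < R) : -(R/2) ≤ ∫ r in (R/2)..R, Real.cos (r * k) := by
  have : ∫ r in (R/2)..R, (-1:ℝ) ≤ ∫ r in (R/2)..R, Real.cos (r * k) := by
    apply intervalIntegral.integral_mono_on (by linarith)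
    · exact continuous_const.intervalIntegrable _ _
    · exact (by fun_prop : Continuous fun r : ℝ => Real.cos (r * k)).intervalIntegrable _ _
    · intro x _
      exact Real.neg_one_le_cos _
  simp at this
  linarith

lemma sinc_low (x : ℝ) (hx : 0 ≤ x) (hx' : x ≤ 5/2) : (13/100 : ℝ) ≤ Real.sinc x := by
  rcases hx.eq_or_lt with h | h
  · rw [← h]; simp; norm_num
  rw [Real.sinc_of_ne_zero h.ne', le_div_iff₀ h]
  have h1 : Real.sin x = 2 * Real.sin (x/2) * Real.cos (x/2) := by
    rw [← Real.sin_two_mul]; ring_nf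
  have hp := Real.pi_gt_three
  have hp2 := Real.pi_lt_d2
  have h2 := Real.mul_le_sin (x := x/2) (by linarith) (by linarith)
  have h3 := Real.one_sub_sq_div_two_le_cos (x := x/2)
  have h4 : (0.63:ℝ) ≤ 2 / π := by
    rw [le_div_iff₀ (by linarith)]; linarith
  have h5 : 0.63 * (x/2) ≤ Real.sin (x/2) := le_trans (by gcongr) h2
  have h6 : (0.21:ℝ) ≤ Real.cos (x/2) := by nlinarith
  rw [h1]
  have : 0.63 * (x/2) * 0.21 ≤ Real.sin (x/2) * Real.cos (x/2) := by
    gcongr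
    linarith
  linarith

lemma core (R u v : ℝ) (hR : 0 < R) (hv : 0 ≤ v) (huv : v ≤ u) (hu : 400 ≤ u * R) :
    R / (u ^ 2 + v ^ 2) ^ 2 ≤ ∫ r in (R/2)..R, (oneS r u * oneS r v) ^ 2 := by
  have hu0 : 0 < u := by
    by_contra h
    push Not at h
    nlinarith
  have c0 : ∀ w, Continuous fun r => oneS r w := fun w =>
    oneS_cont.comp (continuous_id.prodMk continuous_const)
  have ccos : ∀ k : ℝ, IntervalIntegrable (fun r : ℝ => Real.cos (r * k)) volume (R/2) R := by
    intro k
    exact (by fun_prop : Continuous fun r : ℝ => Real.cos (r * k)).intervalIntegrable _ _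
  have hJu : ∫ r in (R/2)..R, Real.cos (r * (2 * u)) ≤ R / 400 := by
    refine (le_abs_self _).trans ((J_bound R (2*u) (by linarith)).trans ?_)
    rw [div_le_div_iff₀ (by linarith) (by norm_num)]
    nlinarith
  by_cases hs : v * R ≤ 5/2
  · have step : ∫ r in (R/2)..R, (169/10000 * R^2) * (2 / u^2) * (1 - Real.cos (r * (2 * u)))
        ≤ ∫ r in (R/2)..R, (oneS r u * oneS r v) ^ 2 := by
      apply intervalIntegral.integral_mono_on (by linarith)
      · exact (by fun_prop : Continuous fun r : ℝ => (169/10000 * R^2) * (2 / u^2) *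
          (1 - Real.cos (r * (2 * u)))).intervalIntegrable _ _
      · exact (((c0 u).mul (c0 v)).pow 2).intervalIntegrable _ _
      · intro r hr
        have hr0 : 0 < r := by linarith [hr.1]
        rw [mul_pow, oneS_of_ne r u hr0.ne' hu0.ne']
        have e1 : (2 * Real.sin (r * u) / u) ^ 2 = 2 / u^2 * (1 - Real.cos (r * (2*u))) := by
          have : r * (2 * u) = 2 * (r * u) := by ring
          rw [this, Real.cos_two_mul, Real.cos_sq']
          field_simp
          ring
        have e2 : 13/100 * R ≤ oneS r v := by
          unfold oneS
          have := sinc_low (r * v) (by positivity) (by nlinarith [hr.2])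
          nlinarith [hr.1]
        have e3 : (13/100 * R)^2 ≤ oneS r v ^ 2 := by gcongr
        rw [e1]
        have e4 : 0 ≤ 2 / u^2 * (1 - Real.cos (r * (2*u))) := by
          have := Real.cos_le_one (r * (2*u))
          have : 0 ≤ 1 - Real.cos (r * (2*u)) := by linarith
          positivity
        nlinarith [mul_le_mul_of_nonneg_left e3 e4]
    refine le_trans ?_ step
    rw [intervalIntegral.integral_const_mul, intervalIntegral.integral_sub
      (continuous_const.intervalIntegrable _ _) (ccos _)]
    simp only [intervalIntegral.integral_const, smul_eq_mul, mul_one]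
    have h1 : R * (9/20) ≤ (R - R/2) - ∫ r in (R/2)..R, Real.cos (r * (2 * u)) := by linarith
    have h2 : R / (u^2+v^2)^2 ≤ (169/10000 * R^2) * (2 / u^2) * (R * (9/20)) := by
      have : (169/10000 * R^2) * (2 / u^2) * (R * (9/20)) = (1521/100000 * R^3) / u^2 := by
        field_simp; ring
      rw [this, div_le_div_iff₀ (by positivity) (by positivity)]
      have h3 : (u^2)^2 ≤ (u^2+v^2)^2 := by
        gcongr
        nlinarith [sq_nonneg v]
      have h4 : (400:ℝ)^2 ≤ (u*R)^2 := by gcongr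
      have h5 : R * u^2 ≤ 1521/100000 * R^3 * (u^2)^2 := by
        have : 0 ≤ R * u^2 := by positivity
        nlinarith [mul_le_mul_of_nonneg_left h4 this]
      refine h5.trans ?_
      gcongr
    refine h2.trans ?_
    gcongr
  · push Not at hs
    have hv0 : 0 < v := by
      by_contra h
      push Not at h
      nlinarith
    have e : ∫ r in (R/2)..R, (oneS r u * oneS r v) ^ 2
       = ∫ r in (R/2)..R, 4 / (u^2*v^2) * ((1 - Real.cos (r * (2*u)) - Real.cos (r*(2*v)))
         + (1/2 * Real.cos (r * (2*(u+v))) + 1/2 * Real.cos (r * (2*(u-v))))) := by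
      apply intervalIntegral.integral_congr
      intro r hr
      rw [Set.uIcc_of_le (by linarith)] at hr
      have hr0 : 0 < r := by linarith [hr.1]
      simp only
      rw [oneS_of_ne r u hr0.ne' hu0.ne', oneS_of_ne r v hr0.ne' hv0.ne']
      have a1 : r * (2*(u+v)) = 2*(r*u) + 2*(r*v) := by ring
      have a2 : r * (2*(u-v)) = 2*(r*u) - 2*(r*v) := by ring
      have a3 : r * (2*u) = 2*(r*u) := by ring
      have a4 : r * (2*v) = 2*(r*v) := by ring
      rw [a1, a2, a3, a4, Real.cos_add, Real.cos_sub, Real.cos_two_mul, Real.cos_two_mul,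
        Real.cos_sq', Real.cos_sq']
      field_simp
      ring
    rw [e, intervalIntegral.integral_const_mul, intervalIntegral.integral_add
      (((continuous_const.intervalIntegrable _ _).sub (ccos _)).sub (ccos _))
      (((ccos _).const_mul _).add ((ccos _).const_mul _)),
      intervalIntegral.integral_sub ((continuous_const.intervalIntegrable _ _).sub (ccos _))
        (ccos _),
      intervalIntegral.integral_sub (continuous_const.intervalIntegrable _ _) (ccos _),
      intervalIntegral.integral_add ((ccos _).const_mul _) ((ccos _).const_mul _),
      intervalIntegral.integral_const_mul, intervalIntegral.integral_const_mul]
    simp only [intervalIntegral.integral_const, smul_eq_mul, mul_one]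
    have hJp : -(R/400) ≤ ∫ r in (R/2)..R, Real.cos (r * (2 * (u+v))) := by
      refine le_trans ?_ (neg_abs_le _)
      apply neg_le_neg
      refine (J_bound R (2*(u+v)) (by linarith)).trans ?_
      rw [div_le_div_iff₀ (by linarith) (by norm_num)]
      nlinarith
    have key : 9/100 * R ≤ (R - R/2) - (∫ r in (R/2)..R, Real.cos (r * (2*u)))
        - (∫ r in (R/2)..R, Real.cos (r*(2*v)))
         + (1/2 * (∫ r in (R/2)..R, Real.cos (r * (2*(u+v))))
          + 1/2 * (∫ r in (R/2)..R, Real.cos (r * (2*(u-v))))) := by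
      by_cases hm : v * R ≤ 20
      · have hJv : ∫ r in (R/2)..R, Real.cos (r * (2 * v)) ≤ R * (2/5) := by
          refine (le_abs_self _).trans ((J_bound R (2*v) (by linarith)).trans ?_)
          rw [div_le_iff₀ (by linarith)]
          nlinarith
        have hd : 0 < u - v := by
          by_contra h
          push Not at h
          nlinarith
        have hJm : -(R/380) ≤ ∫ r in (R/2)..R, Real.cos (r * (2 * (u-v))) := by
          refine le_trans ?_ (neg_abs_le _)
          apply neg_le_neg
          refine (J_bound R (2*(u-v)) (by linarith)).trans ?_
          rw [div_le_div_iff₀ (by linarith) (by norm_num)]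
          nlinarith
        linarith
      · push Not at hm
        have hJv : ∫ r in (R/2)..R, Real.cos (r * (2 * v)) ≤ R / 20 := by
          refine (le_abs_self _).trans ((J_bound R (2*v) (by linarith)).trans ?_)
          rw [div_le_div_iff₀ (by linarith) (by norm_num)]
          nlinarith
        have hJm := J_triv R (2*(u-v)) hR
        linarith
    have h2 : R / (u^2+v^2)^2 ≤ 4 / (u^2*v^2) * (9/100 * R) := by
      have : 4 / (u^2*v^2) * (9/100 * R) = (36/100 * R) / (u^2*v^2) := by ring
      rw [this, div_le_div_iff₀ (by positivity) (by positivity)]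
      have h3 : 4 * (u^2*v^2) ≤ (u^2+v^2)^2 := by nlinarith [sq_nonneg (u^2-v^2)]
      have : 0 ≤ u^2*v^2 := by positivity
      nlinarith [mul_le_mul_of_nonneg_left h3 hR.le, mul_nonneg hR.le this]
    refine h2.trans ?_
    gcongr

lemma core' (R u v : ℝ) (hR : 0 < R) (h : 400 ^ 2 * 2 ≤ (u ^ 2 + v ^ 2) * R ^ 2) :
    R / (u ^ 2 + v ^ 2) ^ 2 ≤ ∫ r in (R/2)..R, (oneS r u * oneS r v) ^ 2 := by
  have aux : ∀ u v : ℝ, |v| ≤ |u| → 400 ^ 2 * 2 ≤ (u ^ 2 + v ^ 2) * R ^ 2 →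
      R / (u ^ 2 + v ^ 2) ^ 2 ≤ ∫ r in (R/2)..R, (oneS r u * oneS r v) ^ 2 := by
    intro u v huv h
    have h1 : v^2 ≤ u^2 := sq_le_sq.mpr huv
    have := core R |u| |v| hR (abs_nonneg _) huv (by
      apply le_of_sq_le_sq _ (by positivity)
      rw [mul_pow, sq_abs]
      nlinarith [mul_le_mul_of_nonneg_right h1 (sq_nonneg R)])
    simpa only [sq_abs, oneS_abs] using this
  rcases le_total |v| |u| with h1 | h1
  · exact aux u v h1 h
  · have := aux v u h1 (by linarith)
    rw [add_comm (u^2)]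
    simpa only [mul_comm (oneS _ v)] using this

/-- **Proposition 3 (ii).** There are constants `c'', C > 0` such that for every
`θ ∈ (0, π/4)`, `R > 0` and every `ξ ∈ ℝ²` with `|ξ| ≥ c''/R`, one has
`φ_{R,θ}(ξ) ≥ C/|ξ|⁴`. -/
theorem phi_lower_bound_all_directions :
    ∃ c'' > (0:ℝ), ∃ C > (0:ℝ), ∀ θ : ℝ, θ ∈ Set.Ioo 0 (π/4) → ∀ R : ℝ, 0 < R →
      ∀ ξ : ℝ × ℝ, c'' / R ≤ nrm ξ →
      C / nrm ξ ^ 4 ≤ phi R θ ξ := by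
  have hp := Real.pi_gt_three
  refine ⟨100, by norm_num, 1 / (8 * π ^ 4), by positivity, ?_⟩
  intro θ hθ R hR ξ hξ
  have hθ0 : 0 < θ := hθ.1
  have hn : 0 < nrm ξ := lt_of_lt_of_le (by positivity) hξ
  have hnsq : nrm ξ ^ 2 = ξ.1 ^ 2 + ξ.2 ^ 2 := by
    unfold nrm
    exact Real.sq_sqrt (by positivity)
  set U : ℝ → ℝ := fun ν => 2 * π * (ξ.1 * Real.cos ν + ξ.2 * Real.sin ν) with hU
  set V : ℝ → ℝ := fun ν => 2 * π * (-ξ.1 * Real.sin ν + ξ.2 * Real.cos ν) with hV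
  have hUV : ∀ ν, U ν ^ 2 + V ν ^ 2 = 4 * π ^ 2 * nrm ξ ^ 2 := by
    intro ν
    have := Real.sin_sq_add_cos_sq ν
    rw [hnsq]
    simp only [hU, hV]
    linear_combination 4 * π ^ 2 * (ξ.1 ^ 2 + ξ.2 ^ 2) * this
  have hcU : Continuous U := by fun_prop
  have hcV : Continuous V := by fun_prop
  have hcont : Continuous (fun p : ℝ × ℝ => (oneS p.1 (U p.2) * oneS p.1 (V p.2)) ^ 2) :=
    ((oneS_cont.comp (continuous_fst.prodMk (hcU.comp continuous_snd))).mul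
      (oneS_cont.comp (continuous_fst.prodMk (hcV.comp continuous_snd)))).pow 2
  have e1 : (∫ r in (R/2)..R, ∫ ν in (-θ)..θ, ‖ftSq r ν ξ‖ ^ 2)
      = ∫ r in (R/2)..R, ∫ ν in (-θ)..θ, (oneS r (U ν) * oneS r (V ν)) ^ 2 := by
    apply intervalIntegral.integral_congr
    intro r hr
    rw [Set.uIcc_of_le (by linarith)] at hr
    have hr0 : 0 < r := by linarith [hr.1]
    apply intervalIntegral.integral_congr
    intro ν _
    simp only
    rw [ftSq_eq r ν ξ hr0, Complex.norm_real, Real.norm_eq_abs, sq_abs]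
  have e2 : (∫ r in (R/2)..R, ∫ ν in (-θ)..θ, (oneS r (U ν) * oneS r (V ν)) ^ 2)
      = ∫ ν in (-θ)..θ, ∫ r in (R/2)..R, (oneS r (U ν) * oneS r (V ν)) ^ 2 := by
    apply intervalIntegral_intervalIntegral_swap
    apply IntegrableOn.mono_set (t := Set.uIcc (R/2) R ×ˢ Set.uIcc (-θ) θ)
    · exact hcont.continuousOn.integrableOn_compact (isCompact_uIcc.prod isCompact_uIcc)
    · exact Set.prod_mono Set.uIoc_subset_uIcc Set.uIoc_subset_uIcc
  have hRn : 100 ≤ nrm ξ * R := by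
    rwa [div_le_iff₀ hR] at hξ
  have e3 : ∫ ν in (-θ)..θ, R / (4 * π ^ 2 * nrm ξ ^ 2) ^ 2 ≤
      ∫ ν in (-θ)..θ, ∫ r in (R/2)..R, (oneS r (U ν) * oneS r (V ν)) ^ 2 := by
    apply intervalIntegral.integral_mono_on (by linarith)
    · exact continuous_const.intervalIntegrable _ _
    · apply Continuous.intervalIntegrable
      apply intervalIntegral.continuous_parametric_intervalIntegral_of_continuous'
      exact hcont.comp (continuous_snd.prodMk continuous_fst)
    · intro ν _
      rw [← hUV ν]
      apply core' R _ _ hR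
      rw [hUV]
      have : (100:ℝ)^2 ≤ (nrm ξ * R)^2 := by gcongr
      have h9 : (9:ℝ) ≤ π^2 := by nlinarith
      calc (400:ℝ)^2*2 ≤ 4 * 9 * 100^2 := by norm_num
        _ ≤ 4 * π^2 * (nrm ξ * R)^2 := by gcongr
        _ = _ := by ring
  unfold phi
  rw [e1, e2]
  rw [intervalIntegral.integral_const, smul_eq_mul] at e3
  calc 1 / (8 * π ^ 4) / nrm ξ ^ 4
      = 1 / (R * θ) * ((θ - -θ) * (R / (4 * π ^ 2 * nrm ξ ^ 2) ^ 2)) := by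
        field_simp
        ring
    _ ≤ _ := by gcongr
end
end

section
/- Let R = 1/16. There exist constants c₁, c₂, C > 0 such that for every θ ∈ (0, π/4): (a) for every nonzero ξ ∈ ℝ² with arg(ξ) ∈ (-θ/2, θ/2) and |ξ| ≥ C/θ, one has φ_{R,θ}(ξ) ≥ c₁/(θ·|ξ|³); and (b) for every ξ ∈ ℝ² with |ξ| ≥ C, one has φ_{R,θ}(ξ) ≥ c₂/|ξ|⁴. -/
open Real MeasureTheory Set

noncomputable section

/-- One-dimensional factor of the Fourier transform. -/
def gS (r u : ℝ) : ℝ := 2 * r * Real.sinc (2 * π * r * u)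

/-- Cosine integral. -/
def kC (w : ℝ) : ℝ := ∫ r in (1/32:ℝ)..(1/16), Real.cos (4 * π * w * r)

lemma kC_le (w : ℝ) (hw : 0 < w) : |kC w| ≤ 1 / (2 * π * w) := by
  have hc : 4 * π * w ≠ 0 := by positivity
  have h : kC w = (4 * π * w)⁻¹ * (Real.sin (4 * π * w * (1/16)) - Real.sin (4 * π * w * (1/32))) := by
    unfold kC
    rw [intervalIntegral.integral_comp_mul_left (fun x => Real.cos x) hc, integral_cos, smul_eq_mul]
  rw [h, abs_mul, abs_of_pos (by positivity : (0:ℝ) < (4 * π * w)⁻¹)]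
  have h2 : |Real.sin (4 * π * w * (1/16)) - Real.sin (4 * π * w * (1/32))| ≤ 2 := by
    rw [abs_le]
    have a1 := Real.sin_le_one (4 * π * w * (1/16))
    have a2 := Real.neg_one_le_sin (4 * π * w * (1/16))
    have a3 := Real.sin_le_one (4 * π * w * (1/32))
    have a4 := Real.neg_one_le_sin (4 * π * w * (1/32))
    constructor <;> linarith
  calc (4 * π * w)⁻¹ * _ ≤ (4 * π * w)⁻¹ * 2 := by gcongr
    _ = 1 / (2 * π * w) := by field_simp; norm_num

lemma kC_le' (w : ℝ) (hw : 0 < w) : |kC w| ≤ 1 / (6 * w) := by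
  refine (kC_le w hw).trans ?_
  have := Real.pi_gt_three
  gcongr
  linarith

lemma lin_int (c0 c1 c2 c3 c4 w1 w2 w3 w4 : ℝ) :
    ∫ r in (1/32:ℝ)..(1/16), (c0 + c1 * Real.cos (4 * π * w1 * r) + c2 * Real.cos (4 * π * w2 * r)
      + c3 * Real.cos (4 * π * w3 * r) + c4 * Real.cos (4 * π * w4 * r))
    = c0 / 32 + c1 * kC w1 + c2 * kC w2 + c3 * kC w3 + c4 * kC w4 := by
  unfold kC
  rw [intervalIntegral.integral_add, intervalIntegral.integral_add, intervalIntegral.integral_add,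
    intervalIntegral.integral_add]
  · simp only [intervalIntegral.integral_const_mul, intervalIntegral.integral_const, smul_eq_mul]
    ring
  all_goals exact Continuous.intervalIntegrable (by fun_prop) _ _

lemma sin_sq_int (u : ℝ) (hu : 100 ≤ u) :
    1/100 ≤ ∫ r in (1/32:ℝ)..(1/16), Real.sin (2 * π * r * u) ^ 2 := by
  have e : ∀ r : ℝ, Real.sin (2 * π * r * u) ^ 2 = 1/2 + (-1/2) * Real.cos (4 * π * u * r)
      + 0 * Real.cos (4 * π * 0 * r) + 0 * Real.cos (4 * π * 0 * r) + 0 * Real.cos (4 * π * 0 * r) := by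
    intro r
    have : 4 * π * u * r = 2 * (2 * π * r * u) := by ring
    rw [this, Real.cos_two_mul, Real.sin_sq]; ring
  simp_rw [e]
  rw [lin_int]
  have h := kC_le' u (by linarith)
  have h2 : 1 / (6 * u) ≤ 1 / (6 * 100) := by gcongr
  have := abs_le.1 h
  linarith [this.1, this.2]

lemma sin_sin_expand (u v r : ℝ) : Real.sin (2 * π * r * u) ^ 2 * Real.sin (2 * π * r * v) ^ 2 =
    1/4 + (-1/4) * Real.cos (4 * π * u * r) + (-1/4) * Real.cos (4 * π * v * r)
     + (1/8) * Real.cos (4 * π * (u + v) * r) + (1/8) * Real.cos (4 * π * (u - v) * r) := by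
  have e1 : 4 * π * u * r = 2 * (2 * π * r * u) := by ring
  have e2 : 4 * π * v * r = 2 * (2 * π * r * v) := by ring
  have e3 : 4 * π * (u+v) * r = 2 * (2 * π * r * u) + 2 * (2 * π * r * v) := by ring
  have e4 : 4 * π * (u-v) * r = 2 * (2 * π * r * u) - 2 * (2 * π * r * v) := by ring
  rw [e1, e2, e3, e4, Real.cos_add, Real.cos_sub, Real.cos_two_mul, Real.cos_two_mul,
    Real.sin_sq, Real.sin_sq]
  ring

lemma sin_sin_int (u v : ℝ) (hu : 1000 ≤ u) (hv : 6 ≤ v) (hvu : v ≤ u) :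
    1/1000 ≤ ∫ r in (1/32:ℝ)..(1/16), Real.sin (2 * π * r * u) ^ 2 * Real.sin (2 * π * r * v) ^ 2 := by
  have b1 := abs_le.1 (kC_le' u (by linarith))
  have b3 := abs_le.1 (kC_le' (u + v) (by linarith))
  have d1 : 1 / (6 * u) ≤ 1 / (6 * 1000) := by gcongr
  have d3 : 1 / (6 * (u + v)) ≤ 1 / (6 * 1000) := by gcongr; linarith
  by_cases h : u / 2 ≤ v
  · have b2 := abs_le.1 (kC_le' v (by linarith))
    have d2 : 1 / (6 * v) ≤ 1 / (6 * 500) := by gcongr; linarith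
    have key : ∫ r in (1/32:ℝ)..(1/16), (1/8 + (-1/4) * Real.cos (4 * π * u * r)
        + (-1/4) * Real.cos (4 * π * v * r)
        + (1/8) * Real.cos (4 * π * (u + v) * r) + 0 * Real.cos (4 * π * 0 * r)) ≤
        ∫ r in (1/32:ℝ)..(1/16), Real.sin (2 * π * r * u) ^ 2 * Real.sin (2 * π * r * v) ^ 2 := by
      apply intervalIntegral.integral_mono_on (by norm_num)
      · exact Continuous.intervalIntegrable (by fun_prop) _ _
      · exact Continuous.intervalIntegrable (by fun_prop) _ _
      · intro r _
        rw [sin_sin_expand]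
        linarith [Real.neg_one_le_cos (4 * π * (u - v) * r)]
    rw [lin_int] at key
    linarith [b1.1, b1.2, b2.1, b2.2, b3.1, b3.2]
  · push Not at h
    have b2 := abs_le.1 (kC_le v (by linarith))
    have b4 := abs_le.1 (kC_le' (u - v) (by linarith))
    have d4 : 1 / (6 * (u - v)) ≤ 1 / (6 * 500) := by gcongr; linarith
    have d2 : 1 / (2 * π * v) ≤ 25 / 942 := by
      have := Real.pi_gt_d2
      have : 1 / (2 * π * v) ≤ 1 / (2 * 3.14 * 6) := by gcongr
      exact this.trans (by norm_num)
    simp_rw [sin_sin_expand]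
    rw [lin_int]
    linarith [b1.1, b1.2, b2.1, b2.2, b3.1, b3.2, b4.1, b4.2]

lemma gS_sq (r u : ℝ) (hu : u ≠ 0) (hr : r ≠ 0) : gS r u ^ 2 = (1 / (π^2 * u^2)) * Real.sin (2 * π * r * u) ^ 2 := by
  have := Real.pi_ne_zero
  rw [gS, Real.sinc_of_ne_zero (by positivity)]
  field_simp

lemma gS_abs (r u : ℝ) : gS r |u| = gS r u := by
  unfold gS
  rcases abs_choice u with h | h <;> rw [h]
  rw [mul_neg, Real.sinc_neg]

lemma gS_cont (u : ℝ) : Continuous fun r => gS r u := by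
  unfold gS
  fun_prop

lemma gS_low (r v : ℝ) (hr : 1/32 ≤ r) (hr2 : r ≤ 1/16) (hv0 : 0 ≤ v) (hv : v ≤ 6) :
    1 / (1024 * π^2) ≤ gS r v ^ 2 := by
  have hp := Real.pi_pos
  have key : 1 / (32 * π) ≤ gS r v := by
    rcases hv0.eq_or_lt with h | h
    · subst h
      simp only [gS, mul_zero, Real.sinc_zero]
      have := Real.pi_gt_three
      have : 1 / (32 * π) ≤ 1 / (32 * 1) := by gcongr; linarith
      linarith
    · have hx : 0 < 2 * π * r * v := by positivity
      have hx2 : 2 * π * r * v ≤ 3 / 4 * π := by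
        have : r * v ≤ 1/16 * 6 := by gcongr
        nlinarith
      have hs : 2 * π * r * v / (2 * π) ≤ Real.sin (2 * π * r * v) := by
        set x := 2 * π * r * v
        have e : x = 2 * (x / 2) := by ring
        have s1 := Real.mul_le_sin (x := x / 2) (by linarith) (by linarith)
        have s2 := Real.mul_le_sin (x := π / 2 - x / 2) (by linarith) (by linarith)
        rw [Real.sin_pi_div_two_sub] at s2
        have s3 : 1/4 ≤ 2 / π * (π / 2 - x / 2) := by
          have : 2 / π * (π / 2 - x / 2) = 1 - x / π := by field_simp
          rw [this]
          have : x / π ≤ 3/4 := by rw [div_le_iff₀ hp]; exact hx2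
          linarith
        have : Real.sin x = 2 * Real.sin (x/2) * Real.cos (x/2) := by
          conv_lhs => rw [e, Real.sin_two_mul]
        rw [this]
        have : 2 * (2 / π * (x / 2)) * (1/4) ≤ 2 * Real.sin (x/2) * Real.cos (x/2) := by
          have s0 : 0 ≤ 2 / π * (x / 2) := by positivity
          have s4 : 0 ≤ 2 * Real.sin (x/2) := by linarith
          gcongr
          linarith
        refine le_trans (le_of_eq ?_) this
        field_simp
        norm_num
      rw [gS, Real.sinc_of_ne_zero hx.ne']
      have : 2 * r * (2 * π * r * v / (2 * π) / (2 * π * r * v)) ≤ 2 * r * (Real.sin (2 * π * r * v) / (2 * π * r * v)) := by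
        have : 0 ≤ r := by linarith
        gcongr
      refine le_trans ?_ this
      have hr0 : 0 < r := by linarith
      have : 2 * r * (2 * π * r * v / (2 * π) / (2 * π * r * v)) = r / π := by
        field_simp
      rw [this]
      have : 1 / (32 * π) = (1/32) / π := by field_simp
      rw [this]
      gcongr
  calc 1 / (1024 * π^2) = (1 / (32 * π))^2 := by field_simp; norm_num
    _ ≤ _ := by gcongr

/-- Integral over r. -/
def hH (u v : ℝ) : ℝ := ∫ r in (1/32:ℝ)..(1/16), gS r u ^ 2 * gS r v ^ 2

lemma hH_comm (u v : ℝ) : hH u v = hH v u := by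
  unfold hH; simp_rw [mul_comm]

lemma hH_abs (u v : ℝ) : hH |u| |v| = hH u v := by
  unfold hH; simp_rw [gS_abs]

lemma pi4 : π^4 ≤ 100 := by
  have := Real.pi_lt_d2
  have := Real.pi_pos
  calc π^4 ≤ 3.15^4 := by gcongr
    _ ≤ 100 := by norm_num

lemma hH_small (u v : ℝ) (hu : 100 ≤ u) (hv0 : 0 ≤ v) (hv : v ≤ 6) :
    1 / (20000000 * u^2) ≤ hH u v := by
  have hp := Real.pi_pos
  have h1 : ∫ r in (1/32:ℝ)..(1/16), (1 / (1024 * π^2)) * (1 / (π^2 * u^2)) * Real.sin (2 * π * r * u) ^ 2 ≤ hH u v := by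
    unfold hH
    have c1 := gS_cont u
    have c2 := gS_cont v
    apply intervalIntegral.integral_mono_on (by norm_num)
    · exact Continuous.intervalIntegrable (by fun_prop) _ _
    · exact Continuous.intervalIntegrable (by fun_prop) _ _
    · intro r hr
      have := gS_low r v hr.1 hr.2 hv0 hv
      rw [mul_assoc, ← gS_sq r u (by linarith) (by linarith [hr.1]), mul_comm]
      gcongr
  refine le_trans ?_ h1
  rw [intervalIntegral.integral_const_mul]
  have h2 := sin_sq_int u hu
  have h3 := pi4
  calc 1 / (20000000 * u^2) ≤ 1 / (102400 * 100 * u^2) := by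
        gcongr; norm_num
    _ ≤ 1 / (102400 * π^4 * u^2) := by gcongr
    _ = (1 / (1024 * π^2)) * (1 / (π^2 * u^2)) * (1/100) := by field_simp; norm_num
    _ ≤ _ := by gcongr

lemma hH_big (u v : ℝ) (hu : 1000 ≤ u) (hv0 : 6 ≤ v) (hv : v ≤ u) :
    1 / (20000000 * (u^2 * v^2)) ≤ hH u v := by
  have hp := Real.pi_pos
  have hv1 : 0 < v := by linarith
  have h1 : ∫ r in (1/32:ℝ)..(1/16), (1 / (π^2 * u^2)) * (1 / (π^2 * v^2)) * (Real.sin (2 * π * r * u) ^ 2 * Real.sin (2 * π * r * v) ^ 2) ≤ hH u v := by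
    unfold hH
    have c1 := gS_cont u
    have c2 := gS_cont v
    apply intervalIntegral.integral_mono_on (by norm_num)
    · exact Continuous.intervalIntegrable (by fun_prop) _ _
    · exact Continuous.intervalIntegrable (by fun_prop) _ _
    · intro r hr
      rw [gS_sq r u (by linarith) (by linarith [hr.1]), gS_sq r v (by linarith) (by linarith [hr.1])]
      apply le_of_eq; ring
  refine le_trans ?_ h1
  rw [intervalIntegral.integral_const_mul]
  have h2 := sin_sin_int u v hu hv0 hv
  have h3 := pi4
  calc 1 / (20000000 * (u^2 * v^2)) ≤ 1 / (1000 * 100 * (u^2 * v^2)) := by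
        gcongr; norm_num
    _ ≤ 1 / (1000 * π^4 * (u^2 * v^2)) := by gcongr
    _ = (1 / (π^2 * u^2)) * (1 / (π^2 * v^2)) * (1/1000) := by field_simp
    _ ≤ _ := by gcongr

lemma hH_aux (ρ u v : ℝ) (hρ : 2000 ≤ ρ) (h : u^2 + v^2 = ρ^2) (hv0 : 0 ≤ v) (hv : v ≤ u) :
    1 / (20000000 * ρ^4) ≤ hH u v := by
  have hu : 1000 ≤ u := by nlinarith
  rcases le_total v 6 with h6 | h6
  · refine le_trans ?_ (hH_small u v (by linarith) hv0 h6)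
    have : u^2 ≤ ρ^4 := by
      have h1 : u^2 ≤ ρ^2 := by nlinarith [sq_nonneg v]
      have h2 : ρ^2 ≤ ρ^4 := by gcongr <;> [linarith; norm_num]
      linarith
    gcongr
  · refine le_trans ?_ (hH_big u v hu h6 hv)
    have : u^2 * v^2 ≤ ρ^4 := by
      have : ρ^4 = (ρ^2)^2 := by ring
      rw [this, ← h]; nlinarith [sq_nonneg u, sq_nonneg v, sq_nonneg (u*v), sq_nonneg (u^2), sq_nonneg (v^2)]
    gcongr

lemma hH_all (ρ u v : ℝ) (hρ : 2000 ≤ ρ) (h : u^2 + v^2 = ρ^2) :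
    1 / (20000000 * ρ^4) ≤ hH u v := by
  rw [← hH_abs]
  rcases le_total |v| |u| with h1 | h1
  · exact hH_aux ρ _ _ hρ (by simpa using h) (abs_nonneg _) h1
  · rw [hH_comm]
    exact hH_aux ρ _ _ hρ (by simp only [sq_abs]; linarith) (abs_nonneg _) h1

lemma hH_near (ρ u v : ℝ) (hρ : 2000 ≤ ρ) (h : u^2 + v^2 = ρ^2) (hv : |v| ≤ 1) :
    1 / (20000000 * ρ^2) ≤ hH u v := by
  rw [← hH_abs]
  have hv2 : v^2 ≤ 1 := by rwa [sq_le_one_iff_abs_le_one]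
  have hu : 100 ≤ |u| := by
    apply abs_le_of_sq_le_sq' _ (abs_nonneg u) |>.2
    rw [sq_abs]; nlinarith
  refine le_trans ?_ (hH_small |u| |v| hu (abs_nonneg _) (by linarith))
  rw [sq_abs]
  have : u^2 ≤ ρ^2 := by nlinarith [sq_nonneg v]
  have : 0 < u^2 := by nlinarith
  gcongr

lemma one_d (r u : ℝ) (hr : 0 < r) :
    ∫ x in Set.Icc (-r) r, Complex.exp (((-(2 * π * u) * x : ℝ) : ℂ) * Complex.I) = (gS r u : ℂ) := by
  rw [integral_Icc_eq_integral_Ioc, ← intervalIntegral.integral_of_le (by linarith)]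
  unfold gS
  by_cases hu : u = 0
  · subst hu
    simp
    ring
  · have hc : -(2 * π * u) ≠ 0 := by have := Real.pi_ne_zero; simp [hu, this]
    rw [intervalIntegral.integral_comp_mul_left (fun y : ℝ => Complex.exp ((y : ℂ) * Complex.I)) hc]
    have e : -(2 * π * u) * -r = - (-(2 * π * u) * r) := by ring
    rw [e, integral_exp_mul_I_eq_sinc]
    have e2 : -(2 * π * u) * r = -(2 * π * r * u) := by ring
    rw [e2, Real.sinc_neg, Complex.real_smul]
    push_cast
    have : (π : ℂ) ≠ 0 := by exact_mod_cast Real.pi_ne_zero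
    have : (u : ℂ) ≠ 0 := by exact_mod_cast hu
    field_simp

/-- Rotation as a continuous linear map. -/
def rotL (ν : ℝ) : ℝ × ℝ →L[ℝ] ℝ × ℝ :=
  (Matrix.toLin (.finTwoProd ℝ) (.finTwoProd ℝ)
    !![Real.cos ν, -Real.sin ν; Real.sin ν, Real.cos ν]).toContinuousLinearMap

lemma rotL_apply (ν : ℝ) (p : ℝ × ℝ) : rotL ν p = rot ν p := by
  unfold rotL
  rw [Matrix.toLin_finTwoProd_toContinuousLinearMap]
  simp [rot]
  constructor <;> ring

lemma rotL_det (ν : ℝ) : (rotL ν).det = 1 := by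
  unfold rotL
  simp only [LinearMap.det_toContinuousLinearMap, LinearMap.det_toLin, Matrix.det_fin_two_of]
  linarith [Real.cos_sq_add_sin_sq ν]

lemma rot_inj (ν : ℝ) : Function.Injective (rot ν) := by
  intro p q h
  simp only [rot, Prod.mk.injEq] at h
  obtain ⟨h1, h2⟩ := h
  have e := Real.cos_sq_add_sin_sq ν
  ext
  · linear_combination (Real.cos ν) * h1 + Real.sin ν * h2 - (p.1 - q.1) * e
  · linear_combination (-Real.sin ν) * h1 + Real.cos ν * h2 - (p.2 - q.2) * e

lemma ft_eq (r ν : ℝ) (ξ : ℝ × ℝ) (hr : 0 < r) :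
    ftSq r ν ξ = ((gS r (ξ.1 * Real.cos ν + ξ.2 * Real.sin ν) *
      gS r (-ξ.1 * Real.sin ν + ξ.2 * Real.cos ν) : ℝ) : ℂ) := by
  have hm : MeasurableSet (Set.Icc (-r) r ×ˢ Set.Icc (-r) r) := measurableSet_Icc.prod measurableSet_Icc
  have hd : ∀ x ∈ (Set.Icc (-r) r ×ˢ Set.Icc (-r) r), HasFDerivWithinAt (rot ν) (rotL ν) (Set.Icc (-r) r ×ˢ Set.Icc (-r) r) x := by
    intro x _
    have : rot ν = rotL ν := by ext1 p; exact (rotL_apply ν p).symm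
    rw [this]
    exact (rotL ν).hasFDerivWithinAt
  have hmi : MeasurableSet (rot ν '' (Set.Icc (-r) r ×ˢ Set.Icc (-r) r)) :=
    measurable_image_of_fderivWithin hm hd (rot_inj ν).injOn
  have e1 : ftSq r ν ξ = ∫ x in rot ν '' (Set.Icc (-r) r ×ˢ Set.Icc (-r) r),
      Complex.exp (-(2 * (π : ℂ) * Complex.I * ((x.1 * ξ.1 + x.2 * ξ.2 : ℝ) : ℂ))) := by
    rw [← integral_indicator hmi]
    unfold ftSq sqInd
    congr 1
    ext x
    by_cases hx : x ∈ rot ν '' (Set.Icc (-r) r ×ˢ Set.Icc (-r) r)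
    · rw [Set.indicator_of_mem hx, Set.indicator_of_mem hx]; simp
    · rw [Set.indicator_of_notMem hx, Set.indicator_of_notMem hx]; simp
  rw [e1, integral_image_eq_integral_abs_det_fderiv_smul volume hm hd (rot_inj ν).injOn]
  rw [Complex.ofReal_mul, ← one_d r _ hr, ← one_d r _ hr, ← setIntegral_prod_mul]
  rw [← Measure.volume_eq_prod]
  congr 1
  ext x
  rw [rotL_det, abs_one, one_smul, ← Complex.exp_add]
  congr 1
  simp only [rot]
  push_cast
  ring


lemma phi_eq (θ : ℝ) (ξ : ℝ × ℝ) : phi (1/16) θ ξ = 16 / θ * ∫ ν in (-θ)..θ,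
    hH (ξ.1 * Real.cos ν + ξ.2 * Real.sin ν) (-ξ.1 * Real.sin ν + ξ.2 * Real.cos ν) := by
  unfold phi hH
  have e1 : (1:ℝ) / (1/16 * θ) = 16 / θ := by
    rw [← div_div]; norm_num
  rw [e1]
  congr 1
  rw [← intervalIntegral_intervalIntegral_swap (F := fun r ν : ℝ =>
        gS r (ξ.1 * Real.cos ν + ξ.2 * Real.sin ν) ^ 2 *
        gS r (-ξ.1 * Real.sin ν + ξ.2 * Real.cos ν) ^ 2)]
  · have e2 : (1/16:ℝ)/2 = 1/32 := by norm_num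
    rw [e2]
    apply intervalIntegral.integral_congr
    intro r hr
    rw [Set.uIcc_of_le (by norm_num)] at hr
    apply intervalIntegral.integral_congr
    intro ν _
    simp only
    rw [ft_eq r ν ξ (by linarith [hr.1]), Complex.norm_real, Real.norm_eq_abs, sq_abs, mul_pow]
  · have hc : Continuous (Function.uncurry fun r ν : ℝ =>
        gS r (ξ.1 * Real.cos ν + ξ.2 * Real.sin ν) ^ 2 *
        gS r (-ξ.1 * Real.sin ν + ξ.2 * Real.cos ν) ^ 2) := by
      unfold gS Function.uncurry
      fun_prop
    apply (hc.continuousOn.integrableOn_compact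
      (isCompact_uIcc.prod isCompact_uIcc : IsCompact (Set.uIcc (1/32:ℝ) (1/16) ×ˢ Set.uIcc (-θ) θ))).mono_set
    exact Set.prod_mono Set.uIoc_subset_uIcc Set.uIoc_subset_uIcc

lemma hH_cont (ξ : ℝ × ℝ) : Continuous fun ν : ℝ =>
    hH (ξ.1 * Real.cos ν + ξ.2 * Real.sin ν) (-ξ.1 * Real.sin ν + ξ.2 * Real.cos ν) := by
  unfold hH
  apply intervalIntegral.continuous_parametric_intervalIntegral_of_continuous'
  unfold gS Function.uncurry
  fun_prop

lemma hH_nonneg (u v : ℝ) : 0 ≤ hH u v := by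
  unfold hH
  apply intervalIntegral.integral_nonneg (by norm_num)
  intro r _
  positivity

lemma nrm_rot (ξ : ℝ × ℝ) (ν : ℝ) :
    (ξ.1 * Real.cos ν + ξ.2 * Real.sin ν)^2 + (-ξ.1 * Real.sin ν + ξ.2 * Real.cos ν)^2 = nrm ξ ^ 2 := by
  unfold nrm
  rw [Real.sq_sqrt (by positivity)]
  linear_combination (ξ.1^2 + ξ.2^2) * Real.cos_sq_add_sin_sq ν

/-- **Corollary 6.** Fix `R = 1/16`. There are constants `c₁, c₂, C > 0` such that for every
`θ ∈ (0, π/4)`: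
(a) `φ_{R,θ}(ξ) ≥ c₁/(θ|ξ|³)` whenever `arg ξ ∈ (-θ/2, θ/2)` and `|ξ| ≥ C/θ`;
(b) `φ_{R,θ}(ξ) ≥ c₂/|ξ|⁴` whenever `|ξ| ≥ C`. -/
theorem phi_lower_bound_fixed_R :
    ∃ c₁ > (0:ℝ), ∃ c₂ > (0:ℝ), ∃ C > (0:ℝ), ∀ θ : ℝ, θ ∈ Set.Ioo 0 (π/4) →
      (∀ ξ : ℝ × ℝ, ξ ≠ 0 → (∃ α ∈ Set.Ioo (-(θ/2)) (θ/2), hasArg ξ α) →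
        C / θ ≤ nrm ξ → c₁ / (θ * nrm ξ ^ 3) ≤ phi (1/16) θ ξ) ∧
      (∀ ξ : ℝ × ℝ, C ≤ nrm ξ → c₂ / nrm ξ ^ 4 ≤ phi (1/16) θ ξ) := by
  refine ⟨32/20000000, by norm_num, 32/20000000, by norm_num, 2000, by norm_num, ?_⟩
  rintro θ ⟨hθ0, hθ1⟩
  have hθ : θ < 1 := by linarith [Real.pi_lt_four]
  refine ⟨?_, ?_⟩
  · rintro ξ - ⟨α, ⟨ha1, ha2⟩, harg⟩ hC
    have hρ : 2000 ≤ nrm ξ := by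
      refine le_trans ?_ hC
      rw [le_div_iff₀ hθ0]; linarith
    have hρ1 : 2000 ≤ nrm ξ * θ := (div_le_iff₀ hθ0).1 hC
    set ρ := nrm ξ with hρdef
    have hρ0 : 0 < ρ := by linarith
    have hi : 1 / ρ ≤ θ / 2 := by
      rw [div_le_iff₀ hρ0]; linarith
    have hi0 : 0 < 1 / ρ := by positivity
    rw [phi_eq]
    have h1 : ∫ ν in (α - 1/ρ)..(α + 1/ρ), 1 / (20000000 * ρ^2) ≤ ∫ ν in (-θ)..θ,
      hH (ξ.1 * Real.cos ν + ξ.2 * Real.sin ν) (-ξ.1 * Real.sin ν + ξ.2 * Real.cos ν) := by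
      refine le_trans ?_ (intervalIntegral.integral_mono_interval (a := α - 1/ρ) (b := α + 1/ρ)
        (by linarith) (by linarith) (by linarith)
        (Filter.Eventually.of_forall fun ν => hH_nonneg _ _) ((hH_cont ξ).intervalIntegrable _ _))
      apply intervalIntegral.integral_mono_on (by linarith)
      · exact intervalIntegrable_const
      · exact (hH_cont ξ).intervalIntegrable _ _
      · intro ν hν
        apply hH_near ρ _ _ hρ (nrm_rot ξ ν)
        have e : -ξ.1 * Real.sin ν + ξ.2 * Real.cos ν = ρ * Real.sin (α - ν) := by
          have h1 : ξ.1 = ρ * Real.cos α := congrArg Prod.fst harg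
          have h2 : ξ.2 = ρ * Real.sin α := congrArg Prod.snd harg
          rw [h1, h2, Real.sin_sub]; ring
        rw [e, abs_mul, abs_of_pos hρ0]
        have : |Real.sin (α - ν)| ≤ 1 / ρ := by
          refine (Real.abs_sin_le_abs).trans ?_
          rw [abs_le]; constructor <;> linarith [hν.1, hν.2]
        calc ρ * |Real.sin (α - ν)| ≤ ρ * (1/ρ) := by gcongr
          _ = 1 := by field_simp
    rw [intervalIntegral.integral_const, smul_eq_mul] at h1
    calc 32/20000000 / (θ * ρ^3) = 16 / θ * ((α + 1/ρ - (α - 1/ρ)) * (1 / (20000000 * ρ^2))) := by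
          field_simp
          ring
      _ ≤ _ := by gcongr
  · intro ξ hC
    rw [phi_eq]
    have hρ0 : 0 < nrm ξ := by linarith
    have h1 : ∫ ν in (-θ)..θ, 1 / (20000000 * nrm ξ^4) ≤ ∫ ν in (-θ)..θ,
      hH (ξ.1 * Real.cos ν + ξ.2 * Real.sin ν) (-ξ.1 * Real.sin ν + ξ.2 * Real.cos ν) := by
      apply intervalIntegral.integral_mono_on (by linarith)
      · exact intervalIntegrable_const
      · exact (hH_cont ξ).intervalIntegrable _ _
      · intro ν hν
        exact hH_all _ _ _ hC (nrm_rot ξ ν)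
    rw [intervalIntegral.integral_const, smul_eq_mul] at h1
    calc 32/20000000 / (nrm ξ^4) = 16 / θ * ((θ - (-θ)) * (1 / (20000000 * nrm ξ^4))) := by
          field_simp
          ring
      _ ≤ _ := by gcongr
end
end

section
/- There exists a constant c > 0 such that for every natural number N ≥ 1, the optimal discrepancy with respect to the class of rectangles rotated in all directions satisfies D(N, R_{[-π/4,π/4]}) ≥ c·N^{1/4}. -/
open Real MeasureTheory Set

noncomputable section

/-- The unit square `[0,1]²`. -/
def unitSq : Set (ℝ × ℝ) := Set.Icc (0:ℝ) 1 ×ˢ Set.Icc (0:ℝ) 1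

/-- `R` is a closed rectangle having a side making angle `ω` with the x-axis
for some `ω ∈ Ω`. -/
def IsRectIn (Ω : Set ℝ) (R : Set (ℝ × ℝ)) : Prop :=
  ∃ ω ∈ Ω, ∃ a b c d : ℝ, a ≤ b ∧ c ≤ d ∧
    R = rot ω '' (Set.Icc a b ×ˢ Set.Icc c d)

/-- Local discrepancy of the `N`-point set `P` with respect to the set `R`:
`| |P ∩ R| − N · vol(R ∩ [0,1]²) |`. -/
def localDisc (N : ℕ) (P : Finset (ℝ × ℝ)) (R : Set (ℝ × ℝ)) : ℝ :=
  |(((P : Set (ℝ × ℝ)) ∩ R).ncard : ℝ) - (N : ℝ) * (volume (R ∩ unitSq)).toReal|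

/-- Directional discrepancy `D(P, R_Ω)` of a point set `P`. -/
def disc (N : ℕ) (P : Finset (ℝ × ℝ)) (Ω : Set ℝ) : ℝ :=
  sSup {d : ℝ | ∃ R : Set (ℝ × ℝ), IsRectIn Ω R ∧ d = localDisc N P R}

/-- Optimal directional discrepancy `D(N, R_Ω)`. -/
def optDisc (N : ℕ) (Ω : Set ℝ) : ℝ :=
  sInf {d : ℝ | ∃ P : Finset (ℝ × ℝ), ↑P ⊆ unitSq ∧ P.card = N ∧ d = disc N P Ω}

/-- Quadratic form of the signed measure `α - β`. -/
def QF (α β : Measure (ℝ × ℝ)) (k : (ℝ × ℝ) × (ℝ × ℝ) → ℝ) : ℝ :=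
  ∫ w, k w ∂(α.prod α) - 2 * ∫ w, k w ∂(α.prod β) + ∫ w, k w ∂(β.prod β)

lemma ae_prod_mem {S : Set (ℝ × ℝ)} {α β : Measure (ℝ × ℝ)} [IsFiniteMeasure α]
    [IsFiniteMeasure β] (hα : ∀ᵐ x ∂α, x ∈ S) (hβ : ∀ᵐ x ∂β, x ∈ S) :
    ∀ᵐ w ∂(α.prod β), w ∈ S ×ˢ S := by
  have h1 := Measure.quasiMeasurePreserving_fst (μ := α) (ν := β) |>.ae hα
  have h2 := Measure.quasiMeasurePreserving_snd (μ := α) (ν := β) |>.ae hβ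
  filter_upwards [h1, h2] with w a b using ⟨a, b⟩

lemma QF_congr {S : Set (ℝ × ℝ)} {α β : Measure (ℝ × ℝ)} [IsFiniteMeasure α]
    [IsFiniteMeasure β] (hα : ∀ᵐ x ∂α, x ∈ S) (hβ : ∀ᵐ x ∂β, x ∈ S)
    {k k' : (ℝ × ℝ) × (ℝ × ℝ) → ℝ} (h : ∀ w ∈ S ×ˢ S, k w = k' w) :
    QF α β k = QF α β k' := by
  unfold QF
  rw [integral_congr_ae ((ae_prod_mem hα hα).mono h),
    integral_congr_ae ((ae_prod_mem hα hβ).mono h),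
    integral_congr_ae ((ae_prod_mem hβ hβ).mono h)]

lemma swap_aux {Z : Type*} [MeasurableSpace Z] {S : Set (ℝ × ℝ)} {α β : Measure (ℝ × ℝ)}
    [IsFiniteMeasure α] [IsFiniteMeasure β] (hα : ∀ᵐ x ∂α, x ∈ S) (hβ : ∀ᵐ x ∂β, x ∈ S)
    {ζ : Measure Z} [SFinite ζ] {G : (ℝ × ℝ) × (ℝ × ℝ) → Z → ℝ}
    (hm : Measurable (Function.uncurry G)) {g : Z → ℝ} (hg : Integrable g ζ)
    (hb : ∀ w ∈ S ×ˢ S, ∀ z, |G w z| ≤ g z) :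
    Integrable (fun z => ∫ w, G w z ∂(α.prod β)) ζ ∧
    ∫ w, ∫ z, G w z ∂ζ ∂(α.prod β) = ∫ z, ∫ w, G w z ∂(α.prod β) ∂ζ := by
  have hi : Integrable (Function.uncurry G) ((α.prod β).prod ζ) := by
    refine Integrable.mono' (hg.comp_snd (α.prod β)) hm.aestronglyMeasurable ?_
    have := Measure.quasiMeasurePreserving_fst (μ := α.prod β) (ν := ζ) |>.ae (ae_prod_mem hα hβ)
    filter_upwards [this] with w hw
    exact hb _ hw _
  exact ⟨hi.integral_prod_right, integral_integral_swap hi⟩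

lemma QF_swap {Z : Type*} [MeasurableSpace Z] {S : Set (ℝ × ℝ)} {α β : Measure (ℝ × ℝ)}
    [IsFiniteMeasure α] [IsFiniteMeasure β] (hα : ∀ᵐ x ∂α, x ∈ S) (hβ : ∀ᵐ x ∂β, x ∈ S)
    {ζ : Measure Z} [SFinite ζ] {G : (ℝ × ℝ) × (ℝ × ℝ) → Z → ℝ}
    (hm : Measurable (Function.uncurry G)) {g : Z → ℝ} (hg : Integrable g ζ)
    (hb : ∀ w ∈ S ×ˢ S, ∀ z, |G w z| ≤ g z) :
    Integrable (fun z => QF α β (fun w => G w z)) ζ ∧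
    QF α β (fun w => ∫ z, G w z ∂ζ) = ∫ z, QF α β (fun w => G w z) ∂ζ := by
  obtain ⟨a1, a2⟩ := swap_aux hα hα hm hg hb
  obtain ⟨b1, b2⟩ := swap_aux hα hβ hm hg hb
  obtain ⟨c1, c2⟩ := swap_aux hβ hβ hm hg hb
  unfold QF
  refine ⟨(a1.sub (b1.const_mul 2)).add c1, ?_⟩
  have e1 := integral_add (a1.sub (b1.const_mul 2)) c1
  have e2 := integral_sub a1 (b1.const_mul 2)
  simp only [Pi.sub_apply, integral_const_mul] at e1 e2
  rw [e2] at e1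
  simp only [a2, b2, c2]
  exact e1.symm

lemma QF_mul {α β : Measure (ℝ × ℝ)} [IsFiniteMeasure α] [IsFiniteMeasure β] (g : ℝ × ℝ → ℝ) :
    QF α β (fun w => g w.1 * g w.2) = (∫ x, g x ∂α - ∫ x, g x ∂β) ^ 2 := by
  unfold QF
  rw [integral_prod_mul, integral_prod_mul, integral_prod_mul]
  ring

lemma QF_affine {α β : Measure (ℝ × ℝ)} [IsFiniteMeasure α] [IsFiniteMeasure β]
    (hm : α.real univ = β.real univ) {S : Set (ℝ × ℝ)}
    (hα : ∀ᵐ x ∂α, x ∈ S) (hβ : ∀ᵐ x ∂β, x ∈ S) {k : (ℝ × ℝ) × (ℝ × ℝ) → ℝ}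
    (hk : Measurable k) {B : ℝ} (hb : ∀ w ∈ S ×ˢ S, |k w| ≤ B) (a b : ℝ) :
    QF α β (fun w => a + b * k w) = b * QF α β k := by
  have key : ∀ {α β : Measure (ℝ × ℝ)} [IsFiniteMeasure α] [IsFiniteMeasure β],
      (∀ᵐ x ∂α, x ∈ S) → (∀ᵐ x ∂β, x ∈ S) →
      ∫ w, (a + b * k w) ∂(α.prod β) = a * (α.real univ * β.real univ)
        + b * ∫ w, k w ∂(α.prod β) := by
    intro α β _ _ hα hβ
    have hi : Integrable k (α.prod β) := by
      refine Integrable.mono' (integrable_const B) hk.aestronglyMeasurable ?_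
      filter_upwards [ae_prod_mem hα hβ] with w hw using hb w hw
    rw [integral_add (integrable_const a) (hi.const_mul b), integral_const_mul, integral_const]
    congr 1
    simp only [measureReal_def, smul_eq_mul]
    rw [← univ_prod_univ, Measure.prod_prod, ENNReal.toReal_mul]
    ring
  unfold QF
  rw [key hα hα, key hα hβ, key hβ hβ, hm]
  ring

/-- squared distance -/
def sqd (w : (ℝ × ℝ) × (ℝ × ℝ)) : ℝ := (w.1.1 - w.2.1) ^ 2 + (w.1.2 - w.2.2) ^ 2

lemma measurable_sqd : Measurable sqd := by unfold sqd; fun_prop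

lemma sqd_nonneg (w) : 0 ≤ sqd w := by unfold sqd; positivity

lemma sqd_le (w) (hw : w ∈ unitSq ×ˢ unitSq) : sqd w ≤ 2 := by
  obtain ⟨⟨⟨h1, h2⟩, h3, h4⟩, ⟨h5, h6⟩, h7, h8⟩ := hw
  unfold sqd
  nlinarith

lemma gauss2_integrable {b : ℝ} (hb : 0 < b) :
    Integrable (fun z : ℝ × ℝ => Real.exp (-b * (z.1 ^ 2 + z.2 ^ 2))) := by
  have h := (integrable_exp_neg_mul_sq hb).mul_prod (integrable_exp_neg_mul_sq hb)
  rw [← Measure.volume_eq_prod] at h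
  refine h.congr (ae_of_all _ fun z => ?_)
  simp only [← Real.exp_add]
  congr 1; ring

lemma gauss2_integral {b : ℝ} (hb : 0 < b) :
    ∫ z : ℝ × ℝ, Real.exp (-b * (z.1 ^ 2 + z.2 ^ 2)) = π / b := by
  have h := integral_prod_mul (μ := (volume : Measure ℝ)) (ν := (volume : Measure ℝ))
    (fun x : ℝ => Real.exp (-b * x ^ 2)) (fun x : ℝ => Real.exp (-b * x ^ 2))
  rw [← Measure.volume_eq_prod, integral_gaussian, Real.mul_self_sqrt (by positivity)] at h
  rw [← h]
  congr 1; ext z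
  rw [← Real.exp_add]
  congr 1; ring

/-- Positive definiteness of the Gaussian kernel. -/
lemma QF_gauss_nonneg {α β : Measure (ℝ × ℝ)} [IsFiniteMeasure α] [IsFiniteMeasure β]
    (hα : ∀ᵐ x ∂α, x ∈ unitSq) (hβ : ∀ᵐ x ∂β, x ∈ unitSq)
    {b : ℝ} (hb : 0 < b) : 0 ≤ QF α β (fun w => Real.exp (-b * sqd w)) := by
  let h : ℝ × ℝ → ℝ × ℝ → ℝ := fun z x =>
    Real.exp (-(2 * b) * ((z.1 - x.1) ^ 2 + (z.2 - x.2) ^ 2))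
  have hker : ∀ w : (ℝ × ℝ) × (ℝ × ℝ), ∫ z, h z w.1 * h z w.2
      = (π / (4 * b)) * Real.exp (-b * sqd w) := by
    intro w
    rw [← gauss2_integral (show 0 < 4 * b by positivity)]
    rw [← integral_sub_right_eq_self
      (fun z : ℝ × ℝ => Real.exp (-(4 * b) * (z.1 ^ 2 + z.2 ^ 2))) (((w.1.1 + w.2.1) / 2, (w.1.2 + w.2.2) / 2) : ℝ × ℝ),
      ← integral_mul_const]
    congr 1; ext z
    simp only [h, ← Real.exp_add, sqd, Prod.fst_sub, Prod.snd_sub]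
    congr 1; ring
  -- domination on the square
  have hsw := QF_swap (ζ := (volume : Measure (ℝ × ℝ))) hα hβ
    (G := fun w z => h z w.1 * h z w.2)
    (g := fun z => Real.exp (8 * b) * Real.exp (-b * (z.1 ^ 2 + z.2 ^ 2)))
    (by simp only [h]; unfold Function.uncurry; fun_prop)
    ((gauss2_integrable hb).const_mul _) (by
      rintro w ⟨⟨⟨h1, h2⟩, h3, h4⟩, ⟨h5, h6⟩, h7, h8⟩ z
      simp only [h]
      rw [abs_of_pos (by positivity), ← Real.exp_add, ← Real.exp_add]
      apply Real.exp_le_exp.2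
      have aux : ∀ u v : ℝ, 0 ≤ v → v ≤ 1 → u ^ 2 ≤ 2 * (u - v) ^ 2 + 2 := by
        intro u v _ _; nlinarith [sq_nonneg (u - 2 * v)]
      have e1 := aux z.1 _ h1 h2
      have e2 := aux z.2 _ h3 h4
      have e3 := sq_nonneg (z.1 - w.2.1)
      have e4 := sq_nonneg (z.2 - w.2.2)
      nlinarith)
  have h2 := hsw.2
  simp only [hker] at h2
  have h3 : 0 ≤ ∫ z, QF α β (fun w => h z w.1 * h z w.2) := by
    apply integral_nonneg
    intro z
    simp only [QF_mul, Pi.zero_apply]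
    positivity
  rw [← h2] at h3
  have h4 : QF α β (fun w => (π / (4 * b)) * Real.exp (-b * sqd w))
      = (π / (4 * b)) * QF α β (fun w => Real.exp (-b * sqd w)) := by
    unfold QF; simp only [integral_const_mul]; ring
  rw [h4] at h3
  exact nonneg_of_mul_nonneg_right h3 (by positivity)

/-- counting measure of the point set -/
def nuP (P : Finset (ℝ × ℝ)) : Measure (ℝ × ℝ) := ∑ p ∈ P, Measure.dirac p

/-- scaled area measure -/
def laN (N : ℕ) : Measure (ℝ × ℝ) := (N : NNReal) • (volume.restrict unitSq)

lemma measurableSet_unitSq : MeasurableSet unitSq := measurableSet_Icc.prod measurableSet_Icc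

lemma volume_unitSq : volume unitSq = 1 := by
  unfold unitSq
  rw [Measure.volume_eq_prod, Measure.prod_prod]
  simp

instance (P : Finset (ℝ × ℝ)) : IsFiniteMeasure (nuP P) := by
  unfold nuP; infer_instance

instance : IsFiniteMeasure ((volume : Measure (ℝ × ℝ)).restrict unitSq) :=
  ⟨by rw [Measure.restrict_apply_univ, volume_unitSq]; simp⟩

instance (N : ℕ) : IsFiniteMeasure (laN N) := by
  unfold laN; infer_instance

lemma integral_nuP (P : Finset (ℝ × ℝ)) (f : ℝ × ℝ → ℝ) :
    ∫ x, f x ∂(nuP P) = ∑ p ∈ P, f p := by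
  unfold nuP
  rw [integral_finsetSum_measure]
  · simp
  · intro p _
    exact integrable_dirac (by simp)

lemma integral_laN (N : ℕ) (f : ℝ × ℝ → ℝ) :
    ∫ x, f x ∂(laN N) = N * ∫ x in unitSq, f x := by
  unfold laN
  rw [integral_smul_nnreal_measure]
  simp [NNReal.smul_def]

lemma nuP_ae {P : Finset (ℝ × ℝ)} (hP : (P : Set (ℝ × ℝ)) ⊆ unitSq) :
    ∀ᵐ x ∂(nuP P), x ∈ unitSq := by
  rw [ae_iff]
  unfold nuP
  rw [Measure.finsetSum_apply]
  apply Finset.sum_eq_zero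
  intro p hp
  rw [Measure.dirac_apply]
  simpa using hP hp

lemma laN_ae (N : ℕ) : ∀ᵐ x ∂(laN N), x ∈ unitSq := by
  unfold laN
  apply Measure.ae_smul_measure
  exact ae_restrict_mem measurableSet_unitSq

lemma nuP_mass (P : Finset (ℝ × ℝ)) : (nuP P).real univ = P.card := by
  have := integral_nuP P (fun _ => 1)
  simpa using this

lemma laN_mass (N : ℕ) : (laN N).real univ = N := by
  have := integral_laN N (fun _ => 1)
  simpa [measureReal_def, volume_unitSq] using this

lemma gauss_integrable {α β : Measure (ℝ × ℝ)} [IsFiniteMeasure α] [IsFiniteMeasure β]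
    {b : ℝ} (hb : 0 ≤ b) : Integrable (fun w => Real.exp (-b * sqd w)) (α.prod β) := by
  refine Integrable.mono' (integrable_const 1)
    (by have := measurable_sqd; fun_prop) (ae_of_all _ fun w => ?_)
  rw [Real.norm_eq_abs, abs_of_pos (Real.exp_pos _), Real.exp_le_one_iff]
  nlinarith [sqd_nonneg w]

lemma QF_gauss_lower (P : Finset (ℝ × ℝ)) (N : ℕ) (hN : P.card = N) {b : ℝ} (hb : 0 < b) :
    (N : ℝ) - 2 * (N * (N * (π / b))) ≤ QF (nuP P) (laN N) (fun w => Real.exp (-b * sqd w)) := by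
  have h1 : (N : ℝ) ≤ ∫ w, Real.exp (-b * sqd w) ∂((nuP P).prod (nuP P)) := by
    rw [integral_prod _ (gauss_integrable hb.le)]
    simp only [integral_nuP]
    have : (N : ℝ) = ∑ p ∈ P, 1 := by simp [hN]
    rw [this]
    apply Finset.sum_le_sum
    intro p hp
    have := Finset.single_le_sum (f := fun q => Real.exp (-b * sqd (p, q)))
      (fun q _ => (Real.exp_pos _).le) hp
    refine le_trans ?_ this
    simp [sqd]
  have h2 : ∫ w, Real.exp (-b * sqd w) ∂((nuP P).prod (laN N)) ≤ N * (N * (π / b)) := by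
    rw [integral_prod _ (gauss_integrable hb.le)]
    simp only [integral_nuP, integral_laN]
    have : (N : ℝ) * (N * (π / b)) = ∑ p ∈ P, (N * (π / b)) := by simp [hN]
    rw [this]
    apply Finset.sum_le_sum
    intro p hp
    gcongr
    have hs : ∀ y : ℝ × ℝ, Real.exp (-b * sqd (p, y))
        = (fun z : ℝ × ℝ => Real.exp (-b * (z.1 ^ 2 + z.2 ^ 2))) (y - p) := by
      intro y
      simp only [sqd, Prod.fst_sub, Prod.snd_sub]
      congr 1; ring
    simp only [hs]
    rw [← gauss2_integral hb, ← integral_sub_right_eq_self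
      (fun z : ℝ × ℝ => Real.exp (-b * (z.1 ^ 2 + z.2 ^ 2))) p]
    apply setIntegral_le_integral ((gauss2_integrable hb).comp_sub_right p)
    exact ae_of_all _ fun z => (Real.exp_pos _).le
  have h3 : 0 ≤ ∫ w, Real.exp (-b * sqd w) ∂((laN N).prod (laN N)) :=
    integral_nonneg fun w => (Real.exp_pos _).le
  unfold QF
  linarith

lemma scale_integrable {r : ℝ} (hr : 0 ≤ r) :
    IntegrableOn (fun s : ℝ => 1 - Real.exp (-(s⁻¹ ^ 2) * r)) (Ioi 0) := by
  have hle : ∀ s : ℝ, 0 ≤ 1 - Real.exp (-(s⁻¹ ^ 2) * r) := by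
    intro s
    rw [sub_nonneg, Real.exp_le_one_iff]
    have : 0 ≤ s⁻¹ ^ 2 * r := by positivity
    linarith
  have hm : Measurable (fun s : ℝ => 1 - Real.exp (-(s⁻¹ ^ 2) * r)) := by fun_prop
  rw [← Ioc_union_Ioi_eq_Ioi (zero_le_one' ℝ)]
  apply IntegrableOn.union
  · refine Integrable.mono' (integrable_const (1 : ℝ)) hm.aestronglyMeasurable
      (ae_of_all _ fun s => ?_)
    rw [Real.norm_eq_abs, abs_of_nonneg (hle s)]
    linarith [Real.exp_pos (-(s⁻¹ ^ 2) * r)]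
  · have h := (integrableOn_Ioi_rpow_of_lt (show (-2 : ℝ) < -1 by norm_num) one_pos).const_mul r
    refine Integrable.mono' h hm.aestronglyMeasurable ?_
    filter_upwards [ae_restrict_mem measurableSet_Ioi] with s hs
    have hs' : 0 < s := lt_trans one_pos hs
    rw [Real.norm_eq_abs, abs_of_nonneg (hle s)]
    have : s ^ (-2 : ℝ) = s⁻¹ ^ 2 := by
      rw [Real.rpow_neg hs'.le]; norm_num
    rw [this]
    linarith [Real.add_one_le_exp (-(s⁻¹ ^ 2) * r)]

/-- the scaling constant -/
def C2 : ℝ := ∫ s in Ioi (0 : ℝ), (1 - Real.exp (-(s⁻¹ ^ 2)))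

lemma C2_nonneg : 0 ≤ C2 := by
  unfold C2
  apply integral_nonneg
  intro s
  simp only [Pi.zero_apply, sub_nonneg, Real.exp_le_one_iff]
  nlinarith [sq_nonneg s⁻¹]

lemma scale_integral (r : ℝ) (hr : 0 ≤ r) :
    ∫ s in Ioi (0 : ℝ), (Real.exp (-(s⁻¹ ^ 2) * r) - 1) = - C2 * √r := by
  rcases hr.eq_or_lt with rfl | hr
  · simp
  have hq : 0 < √r := Real.sqrt_pos.2 hr
  have h := integral_comp_mul_left_Ioi (fun s : ℝ => Real.exp (-(s⁻¹ ^ 2)) - 1) 0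
    (inv_pos.2 hq)
  have e : ∀ s : ℝ, Real.exp (-((((√r)⁻¹ * s)⁻¹) ^ 2)) - 1 = Real.exp (-(s⁻¹ ^ 2) * r) - 1 := by
    intro s
    congr 2
    rw [mul_inv, inv_inv, mul_pow, Real.sq_sqrt hr.le]; ring
  simp only [e, mul_zero, inv_inv, smul_eq_mul] at h
  rw [h]
  have : ∫ s in Ioi (0 : ℝ), (Real.exp (-(s⁻¹ ^ 2)) - 1) = - C2 := by
    unfold C2
    rw [← integral_neg]; congr 1; ext s; ring
  rw [this]; ring

lemma energy_lower (P : Finset (ℝ × ℝ)) (N : ℕ) (hN : P.card = N) (hN1 : 1 ≤ N)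
    (hP : (P : Set (ℝ × ℝ)) ⊆ unitSq) :
    √N / 8 ≤ - C2 * QF (nuP P) (laN N) (fun w => √(sqd w)) := by
  have hα := nuP_ae hP
  have hβ := laN_ae N
  have hmass : (nuP P).real univ = (laN N).real univ := by rw [nuP_mass, laN_mass, hN]
  obtain ⟨hi, hs⟩ := QF_swap (ζ := volume.restrict (Ioi (0 : ℝ))) hα hβ
    (G := fun w s => Real.exp (-(s⁻¹ ^ 2) * sqd w) - 1)
    (g := fun s => 1 - Real.exp (-(s⁻¹ ^ 2) * 2))
    (by have := measurable_sqd; unfold Function.uncurry; fun_prop)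
    (scale_integrable zero_le_two) (by
      intro w hw s
      have h0 := sqd_nonneg w
      have h2 := sqd_le w hw
      have hsq : 0 ≤ s⁻¹ ^ 2 := by positivity
      rw [abs_sub_comm, abs_of_nonneg]
      · gcongr 1 - Real.exp ?_
        nlinarith
      · rw [sub_nonneg, Real.exp_le_one_iff]; nlinarith)
  have hE : ∀ s : ℝ, QF (nuP P) (laN N) (fun w => Real.exp (-(s⁻¹ ^ 2) * sqd w) - 1)
      = QF (nuP P) (laN N) (fun w => Real.exp (-(s⁻¹ ^ 2) * sqd w)) := by
    intro s
    have := QF_affine hmass hα hβ (k := fun w => Real.exp (-(s⁻¹ ^ 2) * sqd w)) (B := 1)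
      (by have := measurable_sqd; fun_prop) (by
        intro w _
        rw [abs_of_pos (Real.exp_pos _), Real.exp_le_one_iff]
        have := mul_nonneg (sq_nonneg s⁻¹) (sqd_nonneg w)
        linarith) (-1) 1
    simp only [one_mul] at this
    rw [← this]
    congr 1; ext w; ring
  simp only [hE] at hi hs
  simp only [scale_integral _ (sqd_nonneg _)] at hs
  have hl : QF (nuP P) (laN N) (fun w => - C2 * √(sqd w))
      = - C2 * QF (nuP P) (laN N) (fun w => √(sqd w)) := by
    unfold QF; simp only [integral_const_mul]; ring
  rw [← hl, hs]
  have hNp : (0 : ℝ) < N := by exact_mod_cast hN1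
  have hsq : 0 < √(N : ℝ) := Real.sqrt_pos.2 hNp
  set s0 : ℝ := 1 / (4 * √N) with hs0
  have hs0p : 0 < s0 := by positivity
  have step1 : ∫ s in Ioc 0 s0, QF (nuP P) (laN N) (fun w => Real.exp (-(s⁻¹ ^ 2) * sqd w))
      ≤ ∫ s in Ioi 0, QF (nuP P) (laN N) (fun w => Real.exp (-(s⁻¹ ^ 2) * sqd w)) := by
    apply setIntegral_mono_set hi
    · filter_upwards [ae_restrict_mem measurableSet_Ioi] with s hs
      have hs' : 0 < s := hs
      exact QF_gauss_nonneg hα hβ (by positivity)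
    · exact Ioc_subset_Ioi_self.eventuallyLE
  refine le_trans ?_ step1
  have step2 : ∫ s in Ioc 0 s0, (N / 2 : ℝ)
      ≤ ∫ s in Ioc 0 s0, QF (nuP P) (laN N) (fun w => Real.exp (-(s⁻¹ ^ 2) * sqd w)) := by
    apply setIntegral_mono_on
    · simp
    · exact IntegrableOn.mono_set hi Ioc_subset_Ioi_self
    · exact measurableSet_Ioc
    · intro s hs
      refine le_trans ?_ (QF_gauss_lower P N hN (b := s⁻¹ ^ 2) (by have := hs.1; positivity))
      have e : π / s⁻¹ ^ 2 = π * s ^ 2 := by field_simp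
      have hs2 : s ^ 2 ≤ s0 ^ 2 := by
        have := hs.1; have := hs.2; gcongr
      have e0 : s0 ^ 2 * (16 * N) = 1 := by
        rw [hs0, div_pow, mul_pow, Real.sq_sqrt hNp.le]; field_simp; norm_num
      have e1 : π * s ^ 2 ≤ 4 * s0 ^ 2 := by
        have := Real.pi_le_four
        gcongr
      rw [e]
      have e2 : (N : ℝ) * (π * s ^ 2) ≤ 1 / 4 := by nlinarith
      nlinarith
  refine le_trans (le_of_eq ?_) step2
  rw [setIntegral_const]
  simp only [measureReal_def, Real.volume_Ioc, sub_zero, ENNReal.toReal_ofReal hs0p.le, smul_eq_mul]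
  rw [hs0]
  nth_rewrite 3 [← Real.sq_sqrt hNp.le]
  field_simp
  norm_num

/-- indicator of a half plane -/
def ind (x z : ℝ × ℝ) : ℝ := if x.1 * Real.cos z.1 + x.2 * Real.sin z.1 ≤ z.2 then 1 else 0

lemma measurable_ind : Measurable (Function.uncurry ind) := by
  unfold ind Function.uncurry
  apply Measurable.ite _ measurable_const measurable_const
  exact measurableSet_le (by fun_prop) (by fun_prop)

lemma ind_mul_bound (x y z : ℝ × ℝ) : |ind x z * ind y z| ≤ 1 := by
  unfold ind
  split_ifs <;> simp

/-- the parameter measure on half planes -/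
def zet : Measure (ℝ × ℝ) :=
  (volume.restrict (Ioc 0 (2 * π))).prod (volume.restrict (Ioc (-2) 2))

instance : IsFiniteMeasure zet := by unfold zet; infer_instance

/-- the Crofton constant -/
def C1 : ℝ := ∫ θ in (0 : ℝ)..(2 * π), |Real.cos θ|

lemma C1_lower : π ≤ C1 := by
  have h : ∫ θ in (0 : ℝ)..(2 * π), Real.cos θ ^ 2 ≤ C1 := by
    apply intervalIntegral.integral_mono_on (by positivity)
    · exact Continuous.intervalIntegrable (by fun_prop) _ _
    · exact Continuous.intervalIntegrable (by fun_prop) _ _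
    · intro θ _
      rw [← sq_abs]
      have h1 := Real.abs_cos_le_one θ
      have h2 := abs_nonneg (Real.cos θ)
      nlinarith
  rw [integral_cos_sq] at h
  simp at h
  linarith

lemma crofton (u v : ℝ) :
    ∫ θ in (0 : ℝ)..(2 * π), |u * Real.cos θ + v * Real.sin θ| = C1 * √(u ^ 2 + v ^ 2) := by
  set z : ℂ := ⟨u, v⟩
  have hn : ‖z‖ = √(u ^ 2 + v ^ 2) := by
    rw [Complex.norm_eq_sqrt_sq_add_sq]
  have hu : ‖z‖ * Real.cos z.arg = u := Complex.norm_mul_cos_arg z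
  have hv : ‖z‖ * Real.sin z.arg = v := Complex.norm_mul_sin_arg z
  have e : ∀ θ : ℝ, |u * Real.cos θ + v * Real.sin θ| = ‖z‖ * |Real.cos (θ - z.arg)| := by
    intro θ
    rw [← abs_of_nonneg (norm_nonneg z), ← abs_mul, Real.cos_sub]
    congr 1
    nth_rewrite 1 [← hu, ← hv]
    ring
  simp only [e]
  rw [intervalIntegral.integral_const_mul, hn, mul_comm]
  congr 1
  rw [intervalIntegral.integral_comp_sub_right (fun θ => |Real.cos θ|)]
  have hp : Function.Periodic (fun θ => |Real.cos θ|) (2 * π) := by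
    intro θ; simp
  have := hp.intervalIntegral_add_eq (0 - z.arg) 0
  unfold C1
  rw [zero_add] at this
  rw [← this]
  congr 1; ring

lemma lin_bound {x : ℝ × ℝ} (hx : x ∈ unitSq) (θ : ℝ) :
    -2 < x.1 * Real.cos θ + x.2 * Real.sin θ ∧ x.1 * Real.cos θ + x.2 * Real.sin θ < 2 := by
  obtain ⟨⟨h1, h2⟩, h3, h4⟩ := hx
  have hc := Real.cos_sq_add_sin_sq θ
  apply abs_lt.1
  apply abs_lt_of_sq_lt_sq _ (by norm_num)
  have : (x.1 * Real.cos θ + x.2 * Real.sin θ) ^ 2 + (x.1 * Real.sin θ - x.2 * Real.cos θ) ^ 2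
    = x.1 ^ 2 + x.2 ^ 2 := by
    linear_combination (x.1 ^ 2 + x.2 ^ 2) * hc
  nlinarith [sq_nonneg (x.1 * Real.sin θ - x.2 * Real.cos θ)]

lemma inner_int (a b : ℝ) (ha : -2 < a) (ha2 : a < 2) (hb2 : b < 2) :
    ∫ t in Ioc (-2 : ℝ) 2, (if a ≤ t then (1 : ℝ) else 0) * (if b ≤ t then 1 else 0)
      = 2 - (a + b) / 2 - |a - b| / 2 := by
  have e : ∀ t : ℝ, (if a ≤ t then (1 : ℝ) else 0) * (if b ≤ t then 1 else 0)
      = (Ici (max a b)).indicator (fun _ => 1) t := by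
    intro t
    by_cases h1 : a ≤ t <;> by_cases h2 : b ≤ t <;> simp [indicator, h1, h2]
  simp only [e]
  rw [setIntegral_indicator measurableSet_Ici, setIntegral_const]
  have : Ioc (-2 : ℝ) 2 ∩ Ici (max a b) = Icc (max a b) 2 := by
    ext t
    simp only [mem_inter_iff, mem_Ioc, mem_Ici, mem_Icc]
    constructor
    · rintro ⟨⟨_, h⟩, h'⟩; exact ⟨h', h⟩
    · rintro ⟨h, h'⟩
      exact ⟨⟨lt_of_lt_of_le ha (le_trans (le_max_left _ _) h), h'⟩, h⟩
  rw [this, measureReal_def, Real.volume_Icc, ENNReal.toReal_ofReal (by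
    have := max_lt ha2 hb2; linarith), smul_eq_mul, mul_one]
  rcases le_total a b with hab | hab
  · rw [max_eq_right hab, abs_of_nonpos (by linarith)]; ring
  · rw [max_eq_left hab, abs_of_nonneg (by linarith)]; ring

lemma kernel_eq (w : (ℝ × ℝ) × (ℝ × ℝ)) (hw : w ∈ unitSq ×ˢ unitSq) :
    ∫ z, ind w.1 z * ind w.2 z ∂zet = 4 * π + (-(C1 / 2)) * √(sqd w) := by
  have hi : Integrable (fun z => ind w.1 z * ind w.2 z) zet := by
    refine Integrable.mono' (integrable_const 1) ?_ (ae_of_all _ fun z => ind_mul_bound _ _ _)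
    have h1 : Measurable (ind w.1) := measurable_ind.of_uncurry_left
    have h2 : Measurable (ind w.2) := measurable_ind.of_uncurry_left
    exact (h1.mul h2).aestronglyMeasurable
  unfold zet at hi ⊢
  rw [integral_prod _ hi]
  simp only [ind]
  have e : ∀ θ : ℝ, _ := fun θ => inner_int _ _ (lin_bound hw.1 θ).1 (lin_bound hw.1 θ).2
    (lin_bound hw.2 θ).2
  simp only [e]
  rw [← intervalIntegral.integral_of_le (by positivity)]
  have e2 : ∀ θ : ℝ, 2 - (w.1.1 * Real.cos θ + w.1.2 * Real.sin θ
      + (w.2.1 * Real.cos θ + w.2.2 * Real.sin θ)) / 2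
      - |w.1.1 * Real.cos θ + w.1.2 * Real.sin θ - (w.2.1 * Real.cos θ + w.2.2 * Real.sin θ)| / 2
      = (2 + (-(w.1.1 + w.2.1) / 2) * Real.cos θ + (-(w.1.2 + w.2.2) / 2) * Real.sin θ)
        + (-1 / 2) * |(w.1.1 - w.2.1) * Real.cos θ + (w.1.2 - w.2.2) * Real.sin θ| := by
    intro θ
    rw [show w.1.1 * Real.cos θ + w.1.2 * Real.sin θ - (w.2.1 * Real.cos θ + w.2.2 * Real.sin θ)
      = (w.1.1 - w.2.1) * Real.cos θ + (w.1.2 - w.2.2) * Real.sin θ by ring]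
    ring
  simp only [e2]
  rw [intervalIntegral.integral_add, intervalIntegral.integral_add, intervalIntegral.integral_add,
    intervalIntegral.integral_const_mul, intervalIntegral.integral_const_mul,
    intervalIntegral.integral_const_mul, crofton, integral_cos, integral_sin]
  · simp [sqd]; ring
  all_goals exact Continuous.intervalIntegrable (by fun_prop) _ _

lemma mem_rot_image (ω a b c d : ℝ) (x : ℝ × ℝ) :
    x ∈ rot ω '' (Icc a b ×ˢ Icc c d) ↔
      (x.1 * Real.cos ω + x.2 * Real.sin ω ∈ Icc a b ∧
        -(x.1 * Real.sin ω) + x.2 * Real.cos ω ∈ Icc c d) := by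
  have hc := Real.cos_sq_add_sin_sq ω
  constructor
  · rintro ⟨p, ⟨h1, h2⟩, rfl⟩
    simp only [rot]
    have e1 : (p.1 * Real.cos ω - p.2 * Real.sin ω) * Real.cos ω
      + (p.1 * Real.sin ω + p.2 * Real.cos ω) * Real.sin ω = p.1 := by
      linear_combination p.1 * hc
    have e2 : -((p.1 * Real.cos ω - p.2 * Real.sin ω) * Real.sin ω)
      + (p.1 * Real.sin ω + p.2 * Real.cos ω) * Real.cos ω = p.2 := by
      linear_combination p.2 * hc
    rw [e1, e2]
    exact ⟨h1, h2⟩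
  · rintro ⟨h1, h2⟩
    refine ⟨(_, _), ⟨h1, h2⟩, ?_⟩
    ext
    · simp only [rot]; linear_combination x.1 * hc
    · simp only [rot]; linear_combination x.2 * hc

lemma rect_exists (z : ℝ × ℝ) (h1 : z.1 ∈ Ioc 0 (2 * π)) (h2 : z.2 ∈ Ioc (-2 : ℝ) 2) :
    ∃ R, IsRectIn (Icc (-(π / 4)) (π / 4)) R ∧
      ∀ x ∈ unitSq, x ∈ R ↔ x.1 * Real.cos z.1 + x.2 * Real.sin z.1 ≤ z.2 := by
  obtain ⟨θ, t⟩ := z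
  obtain ⟨ht1, ht2⟩ := h2
  obtain ⟨h3, h4⟩ := h1
  simp only at ht1 ht2 h3 h4 ⊢
  have bd1 : ∀ ω : ℝ, ∀ x ∈ unitSq, -2 < x.1 * Real.cos ω + x.2 * Real.sin ω ∧
    x.1 * Real.cos ω + x.2 * Real.sin ω < 2 := fun ω x hx => lin_bound hx ω
  have bd2 : ∀ ω : ℝ, ∀ x ∈ unitSq, -2 < -(x.1 * Real.sin ω) + x.2 * Real.cos ω ∧
      -(x.1 * Real.sin ω) + x.2 * Real.cos ω < 2 := by
    intro ω x hx
    have := lin_bound hx (ω + π / 2)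
    rw [Real.cos_add_pi_div_two, Real.sin_add_pi_div_two] at this
    simpa using this
  have c1 : ∀ ω ∈ Icc (-(π / 4)) (π / 4), ∃ R, IsRectIn (Icc (-(π / 4)) (π / 4)) R ∧
      ∀ x ∈ unitSq, x ∈ R ↔ x.1 * Real.cos ω + x.2 * Real.sin ω ≤ t := by
    intro ω hω
    refine ⟨_, ⟨ω, hω, -2, t, -2, 2, by linarith, by norm_num, rfl⟩, fun x hx => ?_⟩
    have := bd1 ω x hx
    have := bd2 ω x hx
    rw [mem_rot_image]; simp only [mem_Icc]; grind
  have c2 : ∀ ω ∈ Icc (-(π / 4)) (π / 4), ∃ R, IsRectIn (Icc (-(π / 4)) (π / 4)) R ∧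
      ∀ x ∈ unitSq, x ∈ R ↔ -(x.1 * Real.sin ω) + x.2 * Real.cos ω ≤ t := by
    intro ω hω
    refine ⟨_, ⟨ω, hω, -2, 2, -2, t, by norm_num, by linarith, rfl⟩, fun x hx => ?_⟩
    have := bd1 ω x hx
    have := bd2 ω x hx
    rw [mem_rot_image]; simp only [mem_Icc]; grind
  have c3 : ∀ ω ∈ Icc (-(π / 4)) (π / 4), ∃ R, IsRectIn (Icc (-(π / 4)) (π / 4)) R ∧
      ∀ x ∈ unitSq, x ∈ R ↔ -(x.1 * Real.cos ω + x.2 * Real.sin ω) ≤ t := by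
    intro ω hω
    refine ⟨_, ⟨ω, hω, -t, 2, -2, 2, by linarith, by norm_num, rfl⟩, fun x hx => ?_⟩
    have := bd1 ω x hx
    have := bd2 ω x hx
    rw [mem_rot_image]; simp only [mem_Icc]; grind
  have c4 : ∀ ω ∈ Icc (-(π / 4)) (π / 4), ∃ R, IsRectIn (Icc (-(π / 4)) (π / 4)) R ∧
      ∀ x ∈ unitSq, x ∈ R ↔ -(-(x.1 * Real.sin ω) + x.2 * Real.cos ω) ≤ t := by
    intro ω hω
    refine ⟨_, ⟨ω, hω, -2, 2, -t, 2, by norm_num, by linarith, rfl⟩, fun x hx => ?_⟩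
    have := bd1 ω x hx
    have := bd2 ω x hx
    rw [mem_rot_image]; simp only [mem_Icc]; grind
  by_cases k1 : θ ≤ π / 4
  · exact c1 θ ⟨by linarith, k1⟩
  by_cases k2 : θ ≤ 3 * π / 4
  · obtain ⟨R, hR, h⟩ := c2 (θ - π / 2) ⟨by linarith, by linarith⟩
    refine ⟨R, hR, fun x hx => ?_⟩
    rw [h x hx, Real.sin_sub_pi_div_two, Real.cos_sub_pi_div_two]
    simp
  by_cases k3 : θ ≤ 5 * π / 4
  · obtain ⟨R, hR, h⟩ := c3 (θ - π) ⟨by linarith, by linarith⟩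
    refine ⟨R, hR, fun x hx => ?_⟩
    rw [h x hx, Real.sin_sub_pi, Real.cos_sub_pi]
    ring_nf
  by_cases k4 : θ ≤ 7 * π / 4
  · obtain ⟨R, hR, h⟩ := c4 (θ - π - π / 2) ⟨by linarith, by linarith⟩
    refine ⟨R, hR, fun x hx => ?_⟩
    rw [h x hx, Real.sin_sub_pi_div_two, Real.cos_sub_pi_div_two, Real.sin_sub_pi, Real.cos_sub_pi]
    ring_nf
  · obtain ⟨R, hR, h⟩ := c1 (θ - 2 * π) ⟨by linarith, by linarith⟩
    refine ⟨R, hR, fun x hx => ?_⟩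
    rw [h x hx, Real.sin_sub_two_pi, Real.cos_sub_two_pi]

lemma localDisc_le_disc (N : ℕ) (P : Finset (ℝ × ℝ)) (Ω : Set ℝ) (R : Set (ℝ × ℝ))
    (hR : IsRectIn Ω R) : localDisc N P R ≤ disc N P Ω := by
  apply le_csSup
  · refine ⟨P.card + N, ?_⟩
    rintro d ⟨R, _, rfl⟩
    unfold localDisc
    have h1 : (((P : Set (ℝ × ℝ)) ∩ R).ncard : ℝ) ≤ P.card := by
      have := Set.ncard_le_ncard (inter_subset_left (s := (P : Set (ℝ × ℝ))) (t := R))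
        P.finite_toSet
      rw [Set.ncard_coe_finset] at this
      exact_mod_cast this
    have h2 : (volume (R ∩ unitSq)).toReal ≤ 1 := by
      have : volume (R ∩ unitSq) ≤ 1 := volume_unitSq ▸ measure_mono inter_subset_right
      exact ENNReal.toReal_le_of_le_ofReal zero_le_one (by simpa using this)
    have h3 : 0 ≤ (volume (R ∩ unitSq)).toReal := ENNReal.toReal_nonneg
    have h4 : (0 : ℝ) ≤ N := Nat.cast_nonneg N
    have h5 : (0 : ℝ) ≤ (((P : Set (ℝ × ℝ)) ∩ R).ncard : ℝ) := Nat.cast_nonneg _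
    have h6 : (0 : ℝ) ≤ P.card := Nat.cast_nonneg _
    rw [abs_le]
    constructor <;> nlinarith
  · exact ⟨R, hR, rfl⟩

lemma D_le (P : Finset (ℝ × ℝ)) (N : ℕ) (hP : (P : Set (ℝ × ℝ)) ⊆ unitSq) (z : ℝ × ℝ)
    (h1 : z.1 ∈ Ioc 0 (2 * π)) (h2 : z.2 ∈ Ioc (-2 : ℝ) 2) :
    |∫ x, ind x z ∂(nuP P) - ∫ x, ind x z ∂(laN N)| ≤ disc N P (Icc (-(π / 4)) (π / 4)) := by
  obtain ⟨R, hR, h⟩ := rect_exists z h1 h2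
  refine le_trans (le_of_eq ?_) (localDisc_le_disc N P _ R hR)
  unfold localDisc
  have e1 : ∫ x, ind x z ∂(nuP P) = (((P : Set (ℝ × ℝ)) ∩ R).ncard : ℝ) := by
    classical
    rw [integral_nuP]
    have : (P : Set (ℝ × ℝ)) ∩ R
        = ((P.filter fun x => x.1 * Real.cos z.1 + x.2 * Real.sin z.1 ≤ z.2 : Finset _) : Set _) := by
      ext x
      simp only [mem_inter_iff, Finset.coe_filter, mem_ofPred_eq, Finset.mem_coe]
      exact and_congr_right fun hx => h x (hP hx)
    rw [this, Set.ncard_coe_finset]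
    simp [ind]
  have e2 : ∫ x, ind x z ∂(laN N) = N * (volume (R ∩ unitSq)).toReal := by
    rw [integral_laN]
    congr 1
    have hset : MeasurableSet {x : ℝ × ℝ | x.1 * Real.cos z.1 + x.2 * Real.sin z.1 ≤ z.2} :=
      measurableSet_le (by fun_prop) (by fun_prop)
    have hf : ∀ x : ℝ × ℝ, ind x z
        = {x : ℝ × ℝ | x.1 * Real.cos z.1 + x.2 * Real.sin z.1 ≤ z.2}.indicator (fun _ => 1) x := by
      intro x; simp [ind, indicator]
    simp only [hf]
    rw [setIntegral_indicator hset, setIntegral_const]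
    simp only [measureReal_def, smul_eq_mul, mul_one]
    congr 2
    ext x
    simp only [mem_inter_iff, mem_ofPred_eq]
    constructor
    · rintro ⟨a, b⟩; exact ⟨(h x a).2 b, a⟩
    · rintro ⟨a, b⟩; exact ⟨b, (h x b).1 a⟩
  rw [e1, e2]

lemma energy_upper (P : Finset (ℝ × ℝ)) (N : ℕ) (hN : P.card = N)
    (hP : (P : Set (ℝ × ℝ)) ⊆ unitSq) :
    -(C1 / 2) * QF (nuP P) (laN N) (fun w => √(sqd w))
      ≤ disc N P (Icc (-(π / 4)) (π / 4)) ^ 2 * (8 * π) := by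
  have hα := nuP_ae hP
  have hβ := laN_ae N
  have hmass : (nuP P).real univ = (laN N).real univ := by rw [nuP_mass, laN_mass, hN]
  obtain ⟨hi, hs⟩ := QF_swap (ζ := zet) hα hβ
    (G := fun w z => ind w.1 z * ind w.2 z) (g := fun _ => 1)
    (by
      have m1 := measurable_ind.comp
        (show Measurable (fun q : ((ℝ × ℝ) × (ℝ × ℝ)) × (ℝ × ℝ) => (q.1.1, q.2)) by fun_prop)
      have m2 := measurable_ind.comp
        (show Measurable (fun q : ((ℝ × ℝ) × (ℝ × ℝ)) × (ℝ × ℝ) => (q.1.2, q.2)) by fun_prop)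
      exact m1.mul m2)
    (integrable_const _) (fun w _ z => ind_mul_bound _ _ _)
  rw [QF_congr hα hβ kernel_eq, QF_affine hmass hα hβ (B := √2)
    (by have := measurable_sqd; fun_prop) (by
      intro w hw
      rw [abs_of_nonneg (Real.sqrt_nonneg _)]
      exact Real.sqrt_le_sqrt (sqd_le w hw))] at hs
  rw [hs]
  have hmem : ∀ᵐ z ∂zet, z.1 ∈ Ioc 0 (2 * π) ∧ z.2 ∈ Ioc (-2 : ℝ) 2 := by
    unfold zet
    rw [Measure.prod_restrict]
    filter_upwards [ae_restrict_mem (measurableSet_Ioc.prod measurableSet_Ioc)] with z hz using hz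
  have hb : ∀ᵐ z ∂zet, ‖QF (nuP P) (laN N) (fun w => ind w.1 z * ind w.2 z)‖
      ≤ disc N P (Icc (-(π / 4)) (π / 4)) ^ 2 := by
    filter_upwards [hmem] with z hz
    rw [QF_mul (fun x => ind x z), Real.norm_eq_abs, abs_of_nonneg (sq_nonneg _), ← sq_abs]
    gcongr
    exact D_le P N hP z hz.1 hz.2
  have hle := norm_integral_le_of_norm_le_const hb
  have hz : zet.real univ = 8 * π := by
    unfold zet
    rw [measureReal_def, ← univ_prod_univ, Measure.prod_prod, ENNReal.toReal_mul]
    simp [Real.volume_Ioc, Real.pi_pos.le]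
    ring
  rw [hz] at hle
  exact le_trans (le_abs_self _) hle

/-- **Beck's lower bound for all rotations.** There is a constant `c > 0` such that
for every `N ≥ 1`, `D(N, R_{[-π/4, π/4]}) ≥ c N^{1/4}`. -/
theorem discrepancy_all_rotations_lower_bound :
    ∃ c > (0:ℝ), ∀ N : ℕ, 1 ≤ N →
      c * (N : ℝ) ^ ((1:ℝ)/4) ≤ optDisc N (Set.Icc (-(π/4)) (π/4)) := by
  have hC := C2_nonneg
  have hC1 := C1_lower
  have hpi := Real.pi_pos
  set K : ℝ := 128 * (C2 + 1) with hK
  have hKp : 0 < K := by positivity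
  refine ⟨√(1 / K), by positivity, fun N hN => ?_⟩
  unfold optDisc
  apply le_csInf
  · have hinf : unitSq.Infinite := by
      intro hfin
      have h0 := hfin.measure_zero (volume : Measure (ℝ × ℝ))
      rw [volume_unitSq] at h0
      exact one_ne_zero h0
    obtain ⟨P, hP, hc⟩ := hinf.exists_subset_card_eq N
    exact ⟨_, P, hP, hc, rfl⟩
  · rintro d ⟨P, hP, hc, rfl⟩
    have h1 := energy_lower P N hc hN hP
    have h2 := energy_upper P N hc hP
    have hD : 0 ≤ disc N P (Icc (-(π / 4)) (π / 4)) := by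
      refine le_trans (abs_nonneg _) (D_le P N hP (1, 0) ⟨one_pos, ?_⟩ ⟨?_, ?_⟩) <;>
        norm_num
      linarith [Real.pi_gt_three]
    set D := disc N P (Icc (-(π / 4)) (π / 4))
    set J := - QF (nuP P) (laN N) (fun w => √(sqd w)) with hJ
    have h1' : √N / 8 ≤ C2 * J := by rw [hJ]; linarith
    have hJp : 0 ≤ J := by
      have : 0 ≤ C2 * J := le_trans (by positivity) h1'
      by_contra hneg
      push Not at hneg
      have h3 : C2 * J ≤ 0 := mul_nonpos_of_nonneg_of_nonpos hC hneg.le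
      have hNp : (0 : ℝ) < N := by exact_mod_cast hN
      have : 0 < √(N : ℝ) := Real.sqrt_pos.2 hNp
      linarith
    have h2' : π / 2 * J ≤ D ^ 2 * (8 * π) := by
      refine le_trans ?_ h2
      have : -(C1 / 2) * QF (nuP P) (laN N) (fun w => √(sqd w)) = C1 / 2 * J := by rw [hJ]; ring
      rw [this]
      gcongr
    have h3 : J ≤ 16 * D ^ 2 := by
      have : π * (J - 16 * D ^ 2) ≤ 0 := by linarith
      have := nonpos_of_mul_nonpos_right this hpi
      linarith
    have h4 : √N ≤ K * D ^ 2 := by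
      have : C2 * J ≤ C2 * (16 * D ^ 2) := by gcongr
      rw [hK]; nlinarith [sq_nonneg D]
    have hq : ((N : ℝ) ^ ((1 : ℝ) / 4)) ^ 2 = √N := by
      rw [Real.sqrt_eq_rpow, ← Real.rpow_natCast, ← Real.rpow_mul (Nat.cast_nonneg N)]
      norm_num
    refine (pow_le_pow_iff_left₀ (by positivity) hD two_ne_zero).1 ?_
    rw [mul_pow, hq, Real.sq_sqrt (by positivity), one_div, inv_mul_le_iff₀ hKp]
    exact h4
end
end
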